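/- Let n ≥ 3 and p > (n−1)/2. There is a constant C > 0, depending only on n and p, such that for every measurable V : ℝ^n → ℂ with ‖V‖_{F^p} < ∞ and every Schwartz function g on ℝ^n, ‖ (sin(t√−Δ)/√−Δ) g ‖_{L²_{x,t}(|V|)} ≤ C ‖V‖_{F^p}^{1/2} ‖(√−Δ)^{−1/2} g‖_{L²(ℝ^n)}. -/

import Mathlib

noncomputable section

open MeasureTheory Metric Complex
open scoped ENNReal FourierTransform SchwartzMap

/-- The Fourier multiplier operator `m(√−Δ)` on `ℝⁿ`:
`m(√−Δ)h = 𝓕⁻¹(m(|ξ|) 𝓕h(ξ))`. -/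
def mOp (n : ℕ) (m : ℝ → ℂ) (h : EuclideanSpace ℝ (Fin n) → ℂ) :
    EuclideanSpace ℝ (Fin n) → ℂ :=
  fun x => 𝓕⁻ (fun ξ : EuclideanSpace ℝ (Fin n) => m ‖ξ‖ * 𝓕 h ξ) x

/-- The multiplier of `e^{it√−Δ}`, i.e. `ρ ↦ e^{itρ}`. -/
def expMult (t : ℝ) : ℝ → ℂ := fun ρ => Complex.exp (Complex.I * t * ρ)

/-- The multiplier of `cos(t√−Δ)`, i.e. `ρ ↦ cos (tρ)`. -/
def cosMult (t : ℝ) : ℝ → ℂ := fun ρ => ((Real.cos (t * ρ) : ℝ) : ℂ)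

/-- The multiplier of `sin(t√−Δ)/√−Δ`, i.e. `ρ ↦ sin (tρ)/ρ`. -/
def sincMult (t : ℝ) : ℝ → ℂ := fun ρ => ((Real.sin (t * ρ) / ρ : ℝ) : ℂ)

/-- The multiplier of `sin(t√−Δ)`, i.e. `ρ ↦ sin (tρ)`. -/
def sinMult (t : ℝ) : ℝ → ℂ := fun ρ => ((Real.sin (t * ρ) : ℝ) : ℂ)

/-- The multiplier of `(√−Δ)^γ`, i.e. `ρ ↦ ρ^γ`. -/
def powMult (γ : ℝ) : ℝ → ℂ := fun ρ => ((ρ ^ γ : ℝ) : ℂ)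

/-- A function is Schwartz if it agrees pointwise with some Schwartz map. -/
def IsSchwartz {n : ℕ} (h : EuclideanSpace ℝ (Fin n) → ℂ) : Prop :=
  ∃ φ : 𝓢(EuclideanSpace ℝ (Fin n), ℂ), ∀ x, h x = φ x

/-- The Fefferman–Phong norm
`‖V‖_{𝓕^p} = sup_{x, r>0} r^(2-n/p) (∫_{B_r(x)} |V|^p)^(1/p)`. -/
def fpNorm (n : ℕ) (p : ℝ) (V : EuclideanSpace ℝ (Fin n) → ℂ) : ℝ≥0∞ :=
  ⨆ (x : EuclideanSpace ℝ (Fin n)) (r : ℝ) (_ : 0 < r),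
    ENNReal.ofReal (r ^ (2 - n / p)) *
      (∫⁻ y in ball x r, ENNReal.ofReal (‖V y‖ ^ p)) ^ (1 / p)

/-- The weak `L^{n/2}` quasinorm `sup_{λ>0} λ · |{|V| > λ}|^{2/n}`. -/
def wkNorm (n : ℕ) (V : EuclideanSpace ℝ (Fin n) → ℂ) : ℝ≥0∞ :=
  ⨆ (l : ℝ) (_ : 0 < l),
    ENNReal.ofReal l * (volume {x : EuclideanSpace ℝ (Fin n) | l < ‖V x‖}) ^ ((2 : ℝ) / n)

/-- The mixed norm `‖F‖_{L^q_t L^r_x}` for `F : ℝⁿ × ℝ → ℂ`, curried as `F x t`. -/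
def mixedNorm (n : ℕ) (q r : ℝ) (F : EuclideanSpace ℝ (Fin n) → ℝ → ℂ) : ℝ≥0∞ :=
  (∫⁻ t : ℝ, (∫⁻ x : EuclideanSpace ℝ (Fin n), (‖F x t‖₊ : ℝ≥0∞) ^ r) ^ (q / r)) ^ (1 / q)

/-- The weighted norm `‖h‖_{L²_{x,t}(w)}` with weight `w : ℝⁿ → [0,∞]`. -/
def wtNorm (n : ℕ) (w : EuclideanSpace ℝ (Fin n) → ℝ≥0∞)
    (h : EuclideanSpace ℝ (Fin n) → ℝ → ℂ) : ℝ≥0∞ :=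
  (∫⁻ t : ℝ, ∫⁻ x : EuclideanSpace ℝ (Fin n), (‖h x t‖₊ : ℝ≥0∞) ^ (2 : ℝ) * w x) ^ ((1 : ℝ) / 2)

/-- The homogeneous Sobolev norm `‖h‖_{Ḣ^γ} = ‖(√−Δ)^γ h‖_{L²}`. -/
def sobNorm (n : ℕ) (γ : ℝ) (h : EuclideanSpace ℝ (Fin n) → ℂ) : ℝ≥0∞ :=
  eLpNorm (mOp n (powMult γ) h) 2 volume

/-- The point `x/|x|` of the unit sphere, for `x ≠ 0`. -/
def sphMap (n : ℕ) (x : EuclideanSpace ℝ (Fin n)) (hx : x ≠ 0) :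
    Metric.sphere (0 : EuclideanSpace ℝ (Fin n)) 1 :=
  ⟨‖x‖⁻¹ • x, by
    rw [mem_sphere_zero_iff_norm, norm_smul, norm_inv, norm_norm,
      inv_mul_cancel₀ (norm_ne_zero_iff.mpr hx)]⟩

section Part1
open MeasureTheory Metric Complex
open scoped ENNReal FourierTransform SchwartzMap

set_option maxHeartbeats 1600000 in
theorem fourier_toLp_ae {E : Type*} [NormedAddCommGroup E] [InnerProductSpace ℝ E]
    [FiniteDimensional ℝ E] [MeasurableSpace E] [BorelSpace E] {f : E → ℂ}
    (hf : Integrable f) (hf2 : MemLp f 2 volume) :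
    (𝓕 (hf2.toLp f : Lp (α := E) ℂ 2 volume) : Lp (α := E) ℂ 2 volume) =ᵐ[volume] 𝓕 f := by
  have hcont : Continuous (𝓕 f) := by
    exact VectorFourier.fourierIntegral_continuous Real.continuous_fourierChar (by exact continuous_inner) hf
  apply ae_eq_of_integral_contDiff_smul_eq
  · exact (Lp.memLp _).locallyIntegrable (by norm_num)
  · exact hcont.locallyIntegrable
  intro g hg hgs
  have h1 : HasCompactSupport (fun x => (g x : ℂ)) := hgs.comp_left (g := fun r : ℝ => (r:ℂ)) Complex.ofReal_zero
  have h2 : ContDiff ℝ ((⊤ : ℕ∞) : WithTop ℕ∞) (fun x => (g x : ℂ)) := by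
    exact Complex.ofRealCLM.contDiff.comp hg
  let φ : 𝓢(E, ℂ) := h1.toSchwartzMap h2
  have hφ : ∀ x, φ x = (g x : ℂ) := fun x => rfl
  have key := congrArg (fun T => T φ) (Lp.fourier_toTemperedDistribution_eq (hf2.toLp f : Lp (α := E) ℂ 2 volume))
  simp only [TemperedDistribution.fourier_apply, Lp.toTemperedDistribution_apply] at key
  have e1 : ∫ x, g x • (𝓕 (hf2.toLp f : Lp (α := E) ℂ 2 volume) : Lp (α := E) ℂ 2 volume) x = ∫ x, φ x • (𝓕 (hf2.toLp f : Lp (α := E) ℂ 2 volume) : Lp (α := E) ℂ 2 volume) x := by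
    simp [hφ]
  rw [e1, ← key]
  have e2 : ∫ x, (𝓕 φ) x • (hf2.toLp f) x = ∫ x, (𝓕 (φ : E → ℂ)) x • f x := by
    apply integral_congr_ae
    filter_upwards [hf2.coeFn_toLp] with x hx
    rw [hx, SchwartzMap.fourier_coe]
  rw [e2]
  have := VectorFourier.integral_fourierIntegral_smul_eq_flip (𝕜 := ℝ) (μ := (volume : Measure E)) (ν := (volume : Measure E)) (e := Real.fourierChar) (L := innerₗ E) (f := φ) (g := f) Real.continuous_fourierChar (by exact continuous_inner) φ.integrable hf
  rw [flip_innerₗ] at this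
  refine this.trans ?_
  refine integral_congr_ae (Filter.Eventually.of_forall fun x => ?_)
  have e3 : VectorFourier.fourierIntegral Real.fourierChar volume (innerₗ E) f x = 𝓕 f x := rfl
  simp only [hφ, e3, smul_eq_mul, Complex.real_smul]

theorem plancherel_L1L2 {E : Type*} [NormedAddCommGroup E] [InnerProductSpace ℝ E]
    [FiniteDimensional ℝ E] [MeasurableSpace E] [BorelSpace E] {f : E → ℂ}
    (hf : Integrable f) (hf2 : MemLp f 2 volume) :
    eLpNorm (𝓕 f) 2 volume = eLpNorm f 2 volume := by
  rw [← eLpNorm_congr_ae (fourier_toLp_ae hf hf2), ← Lp.enorm_def]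
  rw [← eLpNorm_congr_ae hf2.coeFn_toLp, ← Lp.enorm_def]
  rw [enorm_eq_iff_norm_eq, Lp.norm_fourier_eq]

theorem plancherel_inv {E : Type*} [NormedAddCommGroup E] [InnerProductSpace ℝ E]
    [FiniteDimensional ℝ E] [MeasurableSpace E] [BorelSpace E] {f : E → ℂ}
    (hf : Integrable f) (hf2 : MemLp f 2 volume) :
    eLpNorm (𝓕⁻ f) 2 volume = eLpNorm f 2 volume := by
  rw [← plancherel_L1L2 hf hf2]
  have : 𝓕⁻ f = 𝓕 f ∘ (fun x => -x) := by
    ext x; rw [Real.fourierInv_eq_fourier_neg]; rfl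
  rw [this]
  apply eLpNorm_comp_measurePreserving _ (Measure.measurePreserving_neg volume)
  exact (VectorFourier.fourierIntegral_continuous Real.continuous_fourierChar (by exact continuous_inner) hf).aestronglyMeasurable

theorem plancherel_lintegral {E : Type*} [NormedAddCommGroup E] [InnerProductSpace ℝ E]
    [FiniteDimensional ℝ E] [MeasurableSpace E] [BorelSpace E] {f : E → ℂ}
    (hf : Integrable f) (hf2 : MemLp f 2 volume) :
    ∫⁻ x, ‖𝓕 f x‖ₑ ^ 2 = ∫⁻ x, ‖f x‖ₑ ^ 2 := by
  have h := plancherel_L1L2 hf hf2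
  have h2 := congrArg (fun z : ℝ≥0∞ => z ^ (2:ℝ)) h
  simp only [eLpNorm_eq_lintegral_rpow_enorm_toReal (p := 2) (by norm_num) (by norm_num), ← ENNReal.rpow_mul] at h2
  simpa using h2

theorem lintegral_polar {E : Type*} [NormedAddCommGroup E] [InnerProductSpace ℝ E]
    [FiniteDimensional ℝ E] [MeasurableSpace E] [BorelSpace E] [Nontrivial E] (f : E → ℝ≥0∞) (hf : Measurable f) :
    ∫⁻ x, f x = ∫⁻ ω : sphere (0:E) 1, ∫⁻ r in Set.Ioi (0:ℝ),
      ENNReal.ofReal (r ^ (Module.finrank ℝ E - 1)) * f (r • (ω:E)) ∂volume ∂(volume : Measure E).toSphere := by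
  have hmp := (volume : Measure E).measurePreserving_homeomorphUnitSphereProd
  have h1 : ∫⁻ x, f x = ∫⁻ z : sphere (0:E) 1 × Set.Ioi (0:ℝ), f ((z.2:ℝ) • (z.1 : E)) ∂((volume : Measure E).toSphere.prod (Measure.volumeIoiPow (Module.finrank ℝ E - 1))) := by
    rw [← hmp.lintegral_comp_emb (Homeomorph.measurableEmbedding _)]
    rw [← restrict_compl_singleton (μ := (volume : Measure E)) 0,
      ← lintegral_subtype_comap (s := {(0:E)}ᶜ) (by measurability)]
    rw [restrict_compl_singleton]
    refine lintegral_congr fun a => ?_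
    have := smul_inv_smul₀ (norm_ne_zero_iff.2 a.2) (a : E)
    simp [this]
  rw [h1, lintegral_prod _ (by fun_prop)]
  congr 1 with ω
  rw [Measure.volumeIoiPow, lintegral_withDensity_eq_lintegral_mul _ (by fun_prop) (by fun_prop)]
  simp only [Pi.mul_apply]
  rw [← lintegral_subtype_comap measurableSet_Ioi]

theorem integral_polar {E : Type*} [NormedAddCommGroup E] [InnerProductSpace ℝ E]
    [FiniteDimensional ℝ E] [MeasurableSpace E] [BorelSpace E] [Nontrivial E] (f : E → ℂ) (hf : Integrable f) :
    Integrable (fun r : ℝ => (r ^ (Module.finrank ℝ E - 1)) • ∫ ω : sphere (0:E) 1, f (r • (ω:E)) ∂(volume : Measure E).toSphere) (volume.restrict (Set.Ioi 0)) ∧ 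
    ∫ x, f x = ∫ r in Set.Ioi (0:ℝ), (r ^ (Module.finrank ℝ E - 1)) • ∫ ω : sphere (0:E) 1, f (r • (ω:E)) ∂(volume : Measure E).toSphere := by
  have hmp := (volume : Measure E).measurePreserving_homeomorphUnitSphereProd
  have hpt : ∀ a : ({0}ᶜ : Set E), f (((homeomorphUnitSphereProd E a).2 : ℝ) • ((homeomorphUnitSphereProd E a).1 : E)) = f a := by
    intro a
    have := smul_inv_smul₀ (norm_ne_zero_iff.2 a.2) (a : E)
    simp [this]
  have h1 : ∫ x, f x = ∫ z : sphere (0:E) 1 × Set.Ioi (0:ℝ), f ((z.2:ℝ) • (z.1 : E)) ∂((volume : Measure E).toSphere.prod (Measure.volumeIoiPow (Module.finrank ℝ E - 1))) := by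
    rw [← hmp.integral_comp (Homeomorph.measurableEmbedding _)]
    rw [← restrict_compl_singleton (μ := (volume : Measure E)) 0,
      ← integral_subtype_comap (s := {(0:E)}ᶜ) (by measurability)]
    rw [restrict_compl_singleton]
    simp only [hpt]
  have h2 : Integrable (fun z : sphere (0:E) 1 × Set.Ioi (0:ℝ) => f ((z.2:ℝ) • (z.1 : E))) ((volume : Measure E).toSphere.prod (Measure.volumeIoiPow (Module.finrank ℝ E - 1))) := by
    rw [← hmp.integrable_comp_emb (Homeomorph.measurableEmbedding _)]
    have : Integrable (fun a : ({0}ᶜ : Set E) => f a) (Measure.comap Subtype.val volume) := by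
      exact (integrableOn_iff_comap_subtypeVal (by measurability)).1 hf.integrableOn
    refine this.congr (Filter.Eventually.of_forall fun a => ?_)
    exact (hpt a).symm
  have h3 := h2.integral_prod_right
  rw [Measure.volumeIoiPow, integrable_withDensity_iff_integrable_smul' (by fun_prop) (by simp)] at h3
  constructor
  · change IntegrableOn _ _ _
    rw [integrableOn_iff_comap_subtypeVal measurableSet_Ioi]
    refine h3.congr (Filter.Eventually.of_forall fun r => ?_)
    have : (0:ℝ) ≤ (r:ℝ) ^ (Module.finrank ℝ E - 1) := pow_nonneg (le_of_lt r.2) _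
    simp [ENNReal.toReal_ofReal this]
  · rw [h1, integral_prod_symm _ h2, Measure.volumeIoiPow, integral_withDensity_eq_integral_toReal_smul (by fun_prop) (by simp)]
    rw [← integral_subtype_comap measurableSet_Ioi]
    refine integral_congr_ae (Filter.Eventually.of_forall fun r => ?_)
    have : (0:ℝ) ≤ (r:ℝ) ^ (Module.finrank ℝ E - 1) := pow_nonneg (le_of_lt r.2) _
    simp only
    rw [ENNReal.toReal_ofReal this]

end Part1

section Part2
open MeasureTheory Metric Complex
open scoped ENNReal FourierTransform SchwartzMap Pointwise

/-- The isometry of the unit sphere induced by a linear isometry equivalence. -/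
def sphIso {E : Type*} [NormedAddCommGroup E] [InnerProductSpace ℝ E] (U : E ≃ₗᵢ[ℝ] E) :
    sphere (0:E) 1 → sphere (0:E) 1 := fun ω => ⟨U ω, by simp⟩

theorem sphIso_measurePreserving {E : Type*} [NormedAddCommGroup E] [InnerProductSpace ℝ E]
    [FiniteDimensional ℝ E] [MeasurableSpace E] [BorelSpace E] (U : E ≃ₗᵢ[ℝ] E) :
    MeasurePreserving (sphIso U) (volume : Measure E).toSphere (volume : Measure E).toSphere := by
  have hm : Measurable (sphIso U) := by
    apply Measurable.subtype_mk
    exact U.continuous.measurable.comp measurable_subtype_coe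
  refine ⟨hm, ?_⟩
  ext s hs
  rw [Measure.map_apply hm hs, Measure.toSphere_apply' _ (hm hs), Measure.toSphere_apply' _ hs]
  congr 1
  have : Set.Ioo (0:ℝ) 1 • ((↑) '' (sphIso U ⁻¹' s) : Set E) = U ⁻¹' (Set.Ioo (0:ℝ) 1 • ((↑) '' s : Set E)) := by
    ext x
    simp only [Set.mem_smul, Set.mem_image, Set.mem_preimage]
    constructor
    · rintro ⟨r, hr, _, ⟨ω, hω, rfl⟩, rfl⟩
      exact ⟨r, hr, _, ⟨_, hω, rfl⟩, by simp [sphIso]⟩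
    · rintro ⟨r, hr, _, ⟨ω, hω, rfl⟩, h⟩
      refine ⟨r, hr, _, ⟨⟨U.symm ω, by simp⟩, ?_, rfl⟩, ?_⟩
      · simpa [sphIso] using hω
      · apply U.injective
        simp [h]
  rw [this]
  exact U.measurePreserving.measure_preimage_equiv (f := U.toHomeomorph.toMeasurableEquiv) _

theorem sph_integral_inv {E : Type*} [NormedAddCommGroup E] [InnerProductSpace ℝ E]
    [FiniteDimensional ℝ E] [MeasurableSpace E] [BorelSpace E] (U : E ≃ₗᵢ[ℝ] E) (F : E → ℝ) (hF : Continuous F) :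
    ∫ ω : sphere (0:E) 1, F (U ω) ∂(volume : Measure E).toSphere = ∫ ω : sphere (0:E) 1, F ω ∂(volume : Measure E).toSphere := by
  have h := sphIso_measurePreserving U
  have h2 := integral_map (μ := (volume : Measure E).toSphere) (φ := sphIso U) h.measurable.aemeasurable
    (f := fun ω : sphere (0:E) 1 => F ω) (by fun_prop)
  rw [h.map_eq] at h2
  rw [h2]
  rfl

/-- radial symmetry -/
theorem sph_radial {E : Type*} [NormedAddCommGroup E] [InnerProductSpace ℝ E]
    [FiniteDimensional ℝ E] [MeasurableSpace E] [BorelSpace E] (x y : E) (h : ‖x‖ = ‖y‖) (F : ℝ → ℝ) (hF : Continuous F) :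
    ∫ ω : sphere (0:E) 1, F (inner ℝ x ω) ∂(volume : Measure E).toSphere = ∫ ω : sphere (0:E) 1, F (inner ℝ y ω) ∂(volume : Measure E).toSphere := by
  have hU := Submodule.reflection_sub h
  set U := (ℝ ∙ (x - y))ᗮ.reflection
  rw [← sph_integral_inv U (fun z => F (inner ℝ y z)) (by fun_prop)]
  simp only [← hU, LinearIsometryEquiv.inner_map_map]

theorem sph_sin {E : Type*} [NormedAddCommGroup E] [InnerProductSpace ℝ E]
    [FiniteDimensional ℝ E] [MeasurableSpace E] [BorelSpace E] (x : E) :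
    ∫ ω : sphere (0:E) 1, Real.sin (inner ℝ x ω) ∂(volume : Measure E).toSphere = 0 := by
  have := sph_radial (-x) x (by simp) Real.sin Real.continuous_sin
  simp only [inner_neg_left, Real.sin_neg, integral_neg] at this
  linarith

theorem hasDerivAt_integral_simple {α : Type*} [MeasurableSpace α] {μ : Measure α} [IsFiniteMeasure μ]
    (f f' : ℝ → α → ℝ) (C : ℝ) (hd : ∀ t a, HasDerivAt (fun s => f s a) (f' t a) t)
    (hf : ∀ t, Measurable (f t)) (hf' : ∀ t, Measurable (f' t))
    (hC : ∀ t a, |f t a| ≤ C) (hC' : ∀ t a, |f' t a| ≤ C) (t : ℝ) :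
    HasDerivAt (fun s => ∫ a, f s a ∂μ) (∫ a, f' t a ∂μ) t := by
  refine (hasDerivAt_integral_of_dominated_loc_of_deriv_le (s := Set.univ) (bound := fun _ => C) Filter.univ_mem ?_ ?_ ?_ ?_ ?_ ?_).2
  · exact Filter.Eventually.of_forall fun s => (hf s).aestronglyMeasurable
  · exact Integrable.of_bound (hf t).aestronglyMeasurable C (Filter.Eventually.of_forall fun a => hC t a)
  · exact (hf' t).aestronglyMeasurable
  · exact Filter.Eventually.of_forall fun a s _ => hC' s a
  · exact integrable_const _
  · exact Filter.Eventually.of_forall fun a s _ => hd s a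

theorem inner_sph_le {E : Type*} [NormedAddCommGroup E] [InnerProductSpace ℝ E] (e : E) (he : ‖e‖ = 1) (ω : sphere (0:E) 1) :
    |inner ℝ e (ω:E)| ≤ 1 := by
  have := abs_real_inner_le_norm e (ω:E)
  simpa [he] using this

/-- second derivative of the constant function along the circle -/
theorem sph_circle {E : Type*} [NormedAddCommGroup E] [InnerProductSpace ℝ E]
    [FiniteDimensional ℝ E] [MeasurableSpace E] [BorelSpace E] (e f : E) (he : ‖e‖ = 1) (hf : ‖f‖ = 1)
    (hef : inner ℝ e f = 0) (r : ℝ) :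
    ∫ ω : sphere (0:E) 1, (r * inner ℝ e (ω:E) * Real.sin (r * inner ℝ e (ω:E))
      - r ^ 2 * (inner ℝ f (ω:E)) ^ 2 * Real.cos (r * inner ℝ e (ω:E))) ∂(volume : Measure E).toSphere = 0 := by
  let a : ℝ → sphere (0:E) 1 → ℝ := fun θ ω => Real.cos θ * inner ℝ e (ω:E) + Real.sin θ * inner ℝ f (ω:E)
  let b : ℝ → sphere (0:E) 1 → ℝ := fun θ ω => - Real.sin θ * inner ℝ e (ω:E) + Real.cos θ * inner ℝ f (ω:E)
  have ham : ∀ θ, Measurable (a θ) := fun θ => by dsimp only [a]; fun_prop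
  have hbm : ∀ θ, Measurable (b θ) := fun θ => by dsimp only [b]; fun_prop
  have hda : ∀ θ ω, HasDerivAt (fun s => a s ω) (b θ ω) θ := fun θ ω =>
    ((Real.hasDerivAt_cos θ).mul_const _).add ((Real.hasDerivAt_sin θ).mul_const _)
  have hdb : ∀ θ ω, HasDerivAt (fun s => b s ω) (- a θ ω) θ := fun θ ω => by
    have h := ((Real.hasDerivAt_sin θ).neg.mul_const (inner ℝ e (ω:E))).add ((Real.hasDerivAt_cos θ).mul_const (inner ℝ f (ω:E)))
    exact h.congr_deriv (by dsimp only [a]; ring)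
  have hb1 : ∀ θ ω, |b θ ω| ≤ 2 := fun θ ω => by
    have h1 := inner_sph_le e he ω
    have h2 := inner_sph_le f hf ω
    refine (abs_add_le _ _).trans ?_
    rw [abs_mul, abs_mul, abs_neg]
    nlinarith [Real.abs_sin_le_one θ, Real.abs_cos_le_one θ, abs_nonneg (Real.sin θ), abs_nonneg (Real.cos θ), abs_nonneg (inner ℝ e (ω:E)), abs_nonneg (inner ℝ f (ω:E))]
  have ha1 : ∀ θ ω, |a θ ω| ≤ 2 := fun θ ω => by
    have h1 := inner_sph_le e he ω
    have h2 := inner_sph_le f hf ω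
    refine (abs_add_le _ _).trans ?_
    rw [abs_mul, abs_mul]
    nlinarith [Real.abs_sin_le_one θ, Real.abs_cos_le_one θ, abs_nonneg (Real.sin θ), abs_nonneg (Real.cos θ), abs_nonneg (inner ℝ e (ω:E)), abs_nonneg (inner ℝ f (ω:E))]
  have hconst : ∀ θ, ∫ ω, Real.cos (r * a θ ω) ∂(volume : Measure E).toSphere = ∫ ω, Real.cos (r * a 0 ω) ∂(volume : Measure E).toSphere := by
    intro θ
    have := sph_radial (r • (Real.cos θ • e + Real.sin θ • f)) (r • e) (by
      rw [norm_smul, norm_smul, he]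
      congr 1
      have : ‖Real.cos θ • e + Real.sin θ • f‖ ^ 2 = 1 := by
        rw [norm_add_sq_real, inner_smul_left, inner_smul_right, hef, norm_smul, norm_smul, he, hf]
        simp
      rw [← sq_eq_sq₀ (norm_nonneg _) (by norm_num), this]; norm_num) Real.cos Real.continuous_cos
    simpa [a, inner_add_left, inner_smul_left, mul_add] using this
  let g1 : ℝ → sphere (0:E) 1 → ℝ := fun θ ω => - Real.sin (r * a θ ω) * (r * b θ ω)
  let g2 : ℝ → sphere (0:E) 1 → ℝ := fun θ ω => -(Real.cos (r * a θ ω) * (r * b θ ω)) * (r * b θ ω) + - Real.sin (r * a θ ω) * (r * (- a θ ω))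
  have hg1 : ∀ θ ω, |g1 θ ω| ≤ |r| * 2 := fun θ ω => by
    simp only [g1, abs_mul, abs_neg]
    have := hb1 θ ω
    have h3 := Real.abs_sin_le_one (r * a θ ω)
    have : |r| * |b θ ω| ≤ |r| * 2 := by gcongr
    nlinarith [abs_nonneg r, abs_nonneg (b θ ω), mul_nonneg (abs_nonneg r) (abs_nonneg (b θ ω))]
  have hg2 : ∀ θ ω, |g2 θ ω| ≤ (|r| * 2) * (|r| * 2) + |r| * 2 := fun θ ω => by
    refine (abs_add_le _ _).trans ?_
    simp only [abs_mul, abs_neg]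
    have := hb1 θ ω
    have := ha1 θ ω
    have h3 := Real.abs_sin_le_one (r * a θ ω)
    have h4 := Real.abs_cos_le_one (r * a θ ω)
    have : |Real.cos (r * a θ ω)| * (|r| * |b θ ω|) * (|r| * |b θ ω|) ≤ 1 * (|r| * 2) * (|r| * 2) := by gcongr
    have : |Real.sin (r * a θ ω)| * (|r| * |a θ ω|)  ≤ 1 * (|r| * 2) := by gcongr
    linarith
  have hr0 := abs_nonneg r
  have d1 := fun θ => hasDerivAt_integral_simple (μ := (volume : Measure E).toSphere) (fun θ ω => Real.cos (r * a θ ω)) g1 (1 + |r| * 2)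
    (fun θ ω => ((hda θ ω).const_mul r).cos) (fun θ => by have := ham θ; fun_prop) (fun θ => by have := ham θ; have := hbm θ; dsimp only [g1]; fun_prop)
    (fun θ ω => by have := Real.abs_cos_le_one (r * a θ ω); linarith) (fun θ ω => by have := hg1 θ ω; linarith) θ
  have z1 : ∀ θ, ∫ ω, g1 θ ω ∂(volume : Measure E).toSphere = 0 := by
    intro θ
    have h := d1 θ
    rw [funext hconst] at h
    exact h.unique (hasDerivAt_const θ _)
  have d2 := hasDerivAt_integral_simple (μ := (volume : Measure E).toSphere) g1 g2 ((|r| * 2) * (|r| * 2) + |r| * 2)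
    (fun θ ω => by
      exact (((hda θ ω).const_mul r).sin.neg).mul ((hdb θ ω).const_mul r)) 
    (fun θ => by have := ham θ; have := hbm θ; dsimp only [g1]; fun_prop) (fun θ => by have := ham θ; have := hbm θ; dsimp only [g2]; fun_prop)
    (fun θ ω => by have := hg1 θ ω; nlinarith) hg2 0
  rw [funext z1] at d2
  have := d2.unique (hasDerivAt_const 0 _)
  rw [← this]
  congr 1 with ω
  simp [g2, a, b]
  ring

end Part2

section Part3
open MeasureTheory Metric Complex
open scoped ENNReal FourierTransform SchwartzMap

theorem sph_ode {E : Type*} [NormedAddCommGroup E] [InnerProductSpace ℝ E]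
    [FiniteDimensional ℝ E] [MeasurableSpace E] [BorelSpace E] (e : E) (he : ‖e‖ = 1) (r : ℝ) :
    ∫ ω : sphere (0:E) 1, (((Module.finrank ℝ E : ℝ) - 1) * (r * inner ℝ e (ω:E) * Real.sin (r * inner ℝ e (ω:E)))
      - r ^ 2 * (1 - (inner ℝ e (ω:E)) ^ 2) * Real.cos (r * inner ℝ e (ω:E))) ∂(volume : Measure E).toSphere = 0 := by
  classical
  have ho : Orthonormal ℝ ((↑) : ({e} : Set E) → E) := by
    constructor
    · rintro ⟨v, rfl⟩; exact he
    · rintro ⟨v, rfl⟩ ⟨w, rfl⟩ h; exact absurd rfl h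
  obtain ⟨u, b, hu, hb⟩ := ho.exists_orthonormalBasis_extension
  have heu : e ∈ u := hu (by simp)
  have hb' : ∀ v : u, b v = v := fun v => by rw [hb]
  have hInt0 : ∀ v ∈ (Finset.univ.erase (⟨e, heu⟩ : u)), Integrable (fun ω : sphere (0:E) 1 => (r * inner ℝ e (ω:E) * Real.sin (r * inner ℝ e (ω:E))
      - r ^ 2 * (inner ℝ (v:E) (ω:E)) ^ 2 * Real.cos (r * inner ℝ e (ω:E)))) (volume : Measure E).toSphere := by
    intro v hv
    exact Continuous.integrable_of_hasCompactSupport (by fun_prop) (HasCompactSupport.of_compactSpace _)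
  have h1 := integral_finsetSum _ hInt0
  rw [Finset.sum_eq_zero] at h1
  · rw [← h1]
    congr 1 with ω
    rw [Finset.sum_sub_distrib, Finset.sum_const, Finset.card_erase_of_mem (Finset.mem_univ _), Finset.card_univ, ← Finset.sum_mul, ← Finset.mul_sum]
    have hc : Fintype.card u = Module.finrank ℝ E := (Module.finrank_eq_card_basis b.toBasis).symm
    have hpos : 1 ≤ Fintype.card u := Fintype.card_pos_iff.2 ⟨⟨e, heu⟩⟩
    have hs : ∑ v ∈ (Finset.univ.erase (⟨e, heu⟩ : u)), (inner ℝ (v:E) (ω:E)) ^ 2 = 1 - (inner ℝ e (ω:E)) ^ 2 := by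
      have h2 := b.sum_sq_inner_right (ω : E)
      simp only [hb'] at h2
      rw [← Finset.add_sum_erase _ _ (Finset.mem_univ (⟨e, heu⟩ : u))] at h2
      have : ‖(ω:E)‖ = 1 := by simp
      rw [this] at h2
      simp only at h2
      linarith
    rw [hs, nsmul_eq_mul, Nat.cast_sub hpos, hc]
    push_cast; ring
  · intro v hv
    have hne := Finset.ne_of_mem_erase hv
    apply sph_circle e v he
    · rw [← hb' v]; exact b.orthonormal.1 v
    · have := b.orthonormal.2 (i := ⟨e, heu⟩) (j := v) hne.symm
      simpa only [hb'] using this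

theorem ode_decay (m : ℕ) (φ φ1 φ2 : ℝ → ℝ) (M : ℝ) (h1 : ∀ r, HasDerivAt φ (φ1 r) r)
    (h2 : ∀ r, HasDerivAt φ1 (φ2 r) r) (hode : ∀ r, m * (r * (-φ1 r)) - r ^ 2 * (φ r + φ2 r) = 0)
    (hM : |φ 1| ≤ M) (hM1 : |φ1 1| ≤ M) (r : ℝ) (hr : 1 ≤ r) :
    r ^ m * φ r ^ 2 ≤ M ^ 2 * ((1 + (m:ℝ) / 2) ^ 2 + 1) * Real.exp (|(m:ℝ) / 2 * ((m:ℝ) / 2 - 1)|) := by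
  set k : ℝ := (m:ℝ) / 2 with hk
  have hk0 : 0 ≤ k := by positivity
  set c : ℝ := k * (k - 1) with hc
  let Q : ℝ → ℝ := fun r => r ^ m * ((φ1 r + k * φ r / r) ^ 2 + φ r ^ 2)
  have hQ : ∀ r > 0, HasDerivAt Q (r ^ m * (2 * (φ1 r + k * φ r / r) * (c / r ^ 2) * φ r)) r := by
    intro r hr
    have e := (hasDerivAt_pow m r).mul ((((h1 r).const_mul k).div (hasDerivAt_id r) hr.ne' |> (h2 r).add).pow 2 |>.add ((h1 r).pow 2))
    refine e.congr_deriv ?_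
    have ho := hode r
    have hr' : r ≠ 0 := hr.ne'
    have hp2 : φ2 r = -φ r - 2 * k / r * φ1 r := by
      have hm2 : (m:ℝ) = 2 * k := by rw [hk]; ring
      rw [hm2] at ho
      have ho' : 2 * k * φ1 r + r * φ r + r * φ2 r = 0 := by
        apply mul_left_cancel₀ hr'
        linear_combination -ho
      rw [eq_sub_iff_add_eq, div_mul_eq_mul_div]
      field_simp
      linear_combination ho'
    have hmk : (m:ℝ) = 2 * k := by rw [hk]; ring
    have hpow : (m:ℝ) * r ^ (m - 1) = 2 * k * r ^ m / r := by
      rcases Nat.eq_zero_or_pos m with h0 | h0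
      · have : k = 0 := by rw [hk, h0]; simp
        simp [h0, this]
      · rw [← hmk, eq_div_iff hr.ne', mul_assoc, ← pow_succ, Nat.sub_add_cancel h0]
    rw [hpow]
    simp only [Pi.add_apply, Pi.pow_apply, Pi.div_apply, id, hp2, hc]
    norm_num
    field_simp
    ring
  let P : ℝ → ℝ := fun r => Q r * Real.exp (|c| / r)
  have hP : ∀ r > 0, HasDerivAt P ((r ^ m * (2 * (φ1 r + k * φ r / r) * (c / r ^ 2) * φ r)) * Real.exp (|c| / r) + Q r * (Real.exp (|c| / r) * (- |c| / r ^ 2))) r := by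
    intro r hr
    refine (hQ r hr).mul ?_
    have := ((hasDerivAt_const r |c|).div (hasDerivAt_id r) hr.ne').exp
    refine this.congr_deriv ?_
    simp
  have hanti : AntitoneOn P (Set.Ici 1) := by
    apply antitoneOn_of_deriv_nonpos (convex_Ici 1)
    · intro r hr
      exact (hP r (lt_of_lt_of_le one_pos hr)).continuousAt.continuousWithinAt
    · intro r hr
      rw [interior_Ici] at hr
      exact (hP r (lt_trans one_pos hr)).differentiableAt.differentiableWithinAt
    · intro r hr
      rw [interior_Ici] at hr
      have hr0 : 0 < r := lt_trans one_pos hr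
      rw [(hP r hr0).deriv]
      have : (r ^ m * (2 * (φ1 r + k * φ r / r) * (c / r ^ 2) * φ r)) * Real.exp (|c| / r) + Q r * (Real.exp (|c| / r) * (- |c| / r ^ 2))
        = (r ^ m * Real.exp (|c| / r) / r ^ 2) * (2 * (φ1 r + k * φ r / r) * φ r * c - |c| * ((φ1 r + k * φ r / r) ^ 2 + φ r ^ 2)) := by
        simp only [Q]; ring
      rw [this]
      apply mul_nonpos_of_nonneg_of_nonpos (by positivity)
      set s := φ1 r + k * φ r / r
      have h3 : |2 * s * φ r| ≤ s ^ 2 + φ r ^ 2 := by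
        rw [abs_le]; constructor <;> nlinarith [sq_nonneg (s + φ r), sq_nonneg (s - φ r)]
      have h4 : 2 * s * φ r * c ≤ |2 * s * φ r| * |c| := by rw [← abs_mul]; exact le_abs_self _
      nlinarith [abs_nonneg c]
  have h5 := hanti (Set.mem_Ici.2 le_rfl) (Set.mem_Ici.2 hr) hr
  have hr0 : 0 < r := by linarith
  have h6 : Q r ≤ P r := by
    have : 0 ≤ Q r := by positivity
    have h7 : 1 ≤ Real.exp (|c| / r) := Real.one_le_exp (by positivity)
    simp only [P]; nlinarith
  have h8 : r ^ m * φ r ^ 2 ≤ Q r := by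
    simp only [Q]
    apply mul_le_mul_of_nonneg_left _ (by positivity)
    nlinarith [sq_nonneg (φ1 r + k * φ r / r)]
  have h9 : P 1 ≤ M ^ 2 * ((1 + k) ^ 2 + 1) * Real.exp |c| := by
    simp only [P, Q, div_one, one_pow, one_mul]
    apply mul_le_mul_of_nonneg_right _ (Real.exp_pos _).le
    have hM0 : 0 ≤ M := (abs_nonneg _).trans hM
    have a1 : |φ1 1 + k * φ 1| ≤ M * (1 + k) := by
      refine (abs_add_le _ _).trans ?_
      rw [abs_mul, abs_of_nonneg hk0]
      nlinarith
    have a2 := sq_le_sq' (by linarith [abs_le.1 a1]) (abs_le.1 a1).2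
    have a3 := sq_le_sq' (by linarith [abs_le.1 hM]) (abs_le.1 hM).2
    nlinarith
  linarith

theorem sph_cos_decay {E : Type*} [NormedAddCommGroup E] [InnerProductSpace ℝ E]
    [FiniteDimensional ℝ E] [MeasurableSpace E] [BorelSpace E] [Nontrivial E] :
    ∃ C : ℝ, 0 ≤ C ∧ ∀ x : E, 1 ≤ ‖x‖ →
      ‖x‖ ^ (Module.finrank ℝ E - 1) * (∫ ω : sphere (0:E) 1, Real.cos (inner ℝ x ω) ∂(volume : Measure E).toSphere) ^ 2 ≤ C := by
  set σ := (volume : Measure E).toSphere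
  set M := σ.real Set.univ
  refine ⟨M ^ 2 * ((1 + ((Module.finrank ℝ E - 1 : ℕ):ℝ) / 2) ^ 2 + 1) * Real.exp (|((Module.finrank ℝ E - 1 : ℕ):ℝ) / 2 * (((Module.finrank ℝ E - 1 : ℕ):ℝ) / 2 - 1)|), by positivity, fun x hx => ?_⟩
  · have hx0 : 0 < ‖x‖ := by linarith
    set e := ‖x‖⁻¹ • x
    have he : ‖e‖ = 1 := by rw [norm_smul, norm_inv, norm_norm, inv_mul_cancel₀ hx0.ne']
    have hxe : x = ‖x‖ • e := by rw [smul_smul, mul_inv_cancel₀ hx0.ne', one_smul]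
    have hie := inner_sph_le e he
    have hbd : ∀ f : sphere (0:E) 1 → ℝ, (∀ ω, |f ω| ≤ 1) → |∫ ω, f ω ∂σ| ≤ M := by
      intro f hf
      have := norm_integral_le_of_norm_le_const (μ := σ) (f := f) (C := 1) (Filter.Eventually.of_forall hf)
      simpa [M] using this
    have key := ode_decay (Module.finrank ℝ E - 1) (fun r => ∫ ω : sphere (0:E) 1, Real.cos (r * inner ℝ e ω) ∂σ)
      (fun r => ∫ ω : sphere (0:E) 1, - Real.sin (r * inner ℝ e ω) * inner ℝ e ω ∂σ)
      (fun r => ∫ ω : sphere (0:E) 1, - (Real.cos (r * inner ℝ e ω) * inner ℝ e ω) * inner ℝ e ω ∂σ) M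
      (fun r => hasDerivAt_integral_simple (μ := σ) (fun r ω => Real.cos (r * inner ℝ e (ω:E)))
          (fun r ω => - Real.sin (r * inner ℝ e (ω:E)) * inner ℝ e (ω:E)) 1 (fun t ω => by
          simpa using ((hasDerivAt_id t).mul_const (inner ℝ e (ω:E))).cos) (fun t => by fun_prop) (fun t => by fun_prop)
          (fun t ω => Real.abs_cos_le_one _) (fun t ω => by
            rw [abs_mul, abs_neg]; exact mul_le_one₀ (Real.abs_sin_le_one _) (abs_nonneg _) (hie ω)) r)
      (fun r => hasDerivAt_integral_simple (μ := σ) (fun r ω => - Real.sin (r * inner ℝ e (ω:E)) * inner ℝ e (ω:E))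
          (fun r ω => - (Real.cos (r * inner ℝ e (ω:E)) * inner ℝ e (ω:E)) * inner ℝ e (ω:E)) 1 (fun t ω => by
          have := (((hasDerivAt_id t).mul_const (inner ℝ e (ω:E))).sin.neg).mul_const (inner ℝ e (ω:E))
          simpa using this) (fun t => by fun_prop) (fun t => by fun_prop)
          (fun t ω => by
            rw [abs_mul, abs_neg]; exact mul_le_one₀ (Real.abs_sin_le_one _) (abs_nonneg _) (hie ω)) (fun t ω => by
            rw [abs_mul, abs_neg, abs_mul]; exact mul_le_one₀ (mul_le_one₀ (Real.abs_cos_le_one _) (abs_nonneg _) (hie ω)) (abs_nonneg _) (hie ω)) r)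
      (fun r => by
        have h := sph_ode e he r
        have hd : (((Module.finrank ℝ E - 1 : ℕ)) : ℝ) = (Module.finrank ℝ E : ℝ) - 1 := by
          rw [Nat.cast_sub Module.finrank_pos]; simp
        rw [hd, ← h]
        have i1 : ∀ f : sphere (0:E) 1 → ℝ, Continuous f → Integrable f σ := fun f hf =>
          hf.integrable_of_hasCompactSupport (HasCompactSupport.of_compactSpace _)
        rw [← integral_neg, ← integral_const_mul, ← integral_const_mul, ← integral_add (i1 _ (by fun_prop)) (i1 _ (by fun_prop)), ← integral_const_mul,
          ← integral_sub (i1 _ (by fun_prop)) (i1 _ (by fun_prop))]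
        congr 1 with ω
        ring)
      (hbd _ fun ω => Real.abs_cos_le_one _)
      (hbd _ fun ω => by
            rw [abs_mul, abs_neg]; exact mul_le_one₀ (Real.abs_sin_le_one _) (abs_nonneg _) (hie ω))
      ‖x‖ hx
    have e3 : ∀ ω : sphere (0:E) 1, ‖x‖ * inner ℝ e (ω:E) = inner ℝ x (ω:E) := by
      intro ω
      rw [← real_inner_smul_left, ← hxe]
    simp only [e3] at key
    exact key

/-- Fourier transform of the surface measure. -/
noncomputable def sphK {E : Type*} [NormedAddCommGroup E] [InnerProductSpace ℝ E]
    [FiniteDimensional ℝ E] [MeasurableSpace E] [BorelSpace E] (x : E) : ℂ :=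
  ∫ ω : sphere (0:E) 1, (Real.fourierChar (-(inner ℝ x (ω:E))) : ℂ) ∂(volume : Measure E).toSphere

theorem sphK_eq {E : Type*} [NormedAddCommGroup E] [InnerProductSpace ℝ E]
    [FiniteDimensional ℝ E] [MeasurableSpace E] [BorelSpace E] (x : E) :
    sphK x = ((∫ ω : sphere (0:E) 1, Real.cos (inner ℝ ((2 * Real.pi) • x) ω) ∂(volume : Measure E).toSphere : ℝ) : ℂ) := by
  have i1 : ∀ f : sphere (0:E) 1 → ℂ, Continuous f → Integrable f (volume : Measure E).toSphere := fun f hf =>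
          hf.integrable_of_hasCompactSupport (HasCompactSupport.of_compactSpace _)
  have hs := sph_sin (-((2 * Real.pi) • x))
  have : ∀ ω : sphere (0:E) 1, (Real.fourierChar (-(inner ℝ x (ω:E))) : ℂ) = ((Real.cos (inner ℝ ((2 * Real.pi) • x) ω) : ℝ) : ℂ) + ((Real.sin (inner ℝ (-((2 * Real.pi) • x)) ω) : ℝ) : ℂ) * Complex.I := by
    intro ω
    rw [Real.fourierChar_apply, Complex.exp_mul_I]
    rw [inner_neg_left, real_inner_smul_left]
    rw [← Complex.ofReal_cos, ← Complex.ofReal_sin, ← Real.cos_neg]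
    congr 5
    all_goals ring
  unfold sphK
  simp only [this]
  rw [integral_add (i1 _ (by fun_prop)) (i1 _ (by fun_prop)), integral_mul_const, integral_complex_ofReal, integral_complex_ofReal, hs]
  simp

theorem sphK_neg {E : Type*} [NormedAddCommGroup E] [InnerProductSpace ℝ E]
    [FiniteDimensional ℝ E] [MeasurableSpace E] [BorelSpace E] (x : E) : sphK (-x) = sphK x := by
  rw [sphK_eq, sphK_eq]
  simp [inner_neg_left]

theorem sphK_cont {E : Type*} [NormedAddCommGroup E] [InnerProductSpace ℝ E]
    [FiniteDimensional ℝ E] [MeasurableSpace E] [BorelSpace E] : Continuous (sphK : E → ℂ) := by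
  unfold sphK
  refine continuous_of_dominated (bound := fun _ => 1) (fun x => ?_) (fun x => ?_) (integrable_const _) ?_
  · apply Continuous.aestronglyMeasurable; fun_prop
  · exact Filter.Eventually.of_forall fun ω => (Circle.norm_coe _).le
  · exact Filter.Eventually.of_forall fun ω => by fun_prop

theorem sphK_decay {E : Type*} [NormedAddCommGroup E] [InnerProductSpace ℝ E]
    [FiniteDimensional ℝ E] [MeasurableSpace E] [BorelSpace E] [Nontrivial E] :
    ∃ C : ℝ, 0 < C ∧ (∀ x : E, ‖sphK x‖ ≤ C) ∧ ∀ x : E, 1 ≤ ‖x‖ → ‖sphK x‖ ≤ C * ‖x‖ ^ (-((Module.finrank ℝ E : ℝ) - 1) / 2) := by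
  obtain ⟨C, hC, h⟩ := sph_cos_decay (E := E)
  refine ⟨Real.sqrt C + (volume : Measure E).toSphere.real Set.univ + 1, by positivity, fun x => ?_, fun x hx => ?_⟩
  · have := norm_integral_le_of_norm_le_const (μ := (volume : Measure E).toSphere) (f := fun ω : sphere (0:E) 1 => (Real.fourierChar (-(inner ℝ x (ω:E))) : ℂ)) (C := 1) (Filter.Eventually.of_forall fun ω => (Circle.norm_coe _).le)
    rw [one_mul] at this
    have h2 := Real.sqrt_nonneg C
    exact this.trans (by linarith)
  · have hx0 : 0 < ‖x‖ := by linarith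
    have h2pi : 1 ≤ 2 * Real.pi := by linarith [Real.pi_gt_three]
    have hn : ‖(2 * Real.pi) • x‖ = 2 * Real.pi * ‖x‖ := by rw [norm_smul, Real.norm_of_nonneg (by positivity)]
    have hle : ‖x‖ ≤ ‖(2 * Real.pi) • x‖ := by rw [hn]; nlinarith
    have h1 := h ((2 * Real.pi) • x) (hx.trans hle)
    rw [sphK_eq, Complex.norm_real]
    set I := ∫ ω : sphere (0:E) 1, Real.cos (inner ℝ ((2 * Real.pi) • x) ω) ∂(volume : Measure E).toSphere
    have h3 : ‖x‖ ^ (Module.finrank ℝ E - 1) * I ^ 2 ≤ C := by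
      refine le_trans ?_ h1
      gcongr
    have h4 : ‖I‖ ^ 2 * ‖x‖ ^ (Module.finrank ℝ E - 1) ≤ (Real.sqrt C) ^ 2 := by
      rw [Real.sq_sqrt hC, Real.norm_eq_abs, sq_abs]; linarith
    have h5 : (‖x‖ ^ (((Module.finrank ℝ E : ℝ) - 1) / 2)) ^ 2 = ‖x‖ ^ (Module.finrank ℝ E - 1) := by
      rw [← Real.rpow_natCast, ← Real.rpow_mul hx0.le, ← Real.rpow_natCast]
      congr 1
      rw [Nat.cast_sub Module.finrank_pos]; push_cast; ring
    rw [← h5, ← mul_pow] at h4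
    have h6 := (sq_le_sq₀ (by positivity) (by positivity)).1 h4
    have h7 : ‖x‖ ^ (-((Module.finrank ℝ E : ℝ) - 1) / 2) = (‖x‖ ^ (((Module.finrank ℝ E : ℝ) - 1) / 2))⁻¹ := by
      rw [← Real.rpow_neg hx0.le]; congr 1; ring
    rw [h7, ← div_eq_mul_inv, le_div_iff₀ (by positivity)]
    have : 0 ≤ (volume : Measure E).toSphere.real Set.univ := measureReal_nonneg
    linarith

end Part3

section Part4
open MeasureTheory Metric Complex
open scoped ENNReal FourierTransform SchwartzMap

theorem tt_star {E Ω : Type*} [NormedAddCommGroup E] [InnerProductSpace ℝ E]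
    [FiniteDimensional ℝ E] [MeasurableSpace E] [BorelSpace E] [MeasurableSpace Ω] (μ : Measure Ω) [SFinite μ]
    (a : Ω → ℂ) (ha : Integrable a μ) (v : Ω → E) (hv : Measurable v) (h : E → ℂ) (hh : Integrable h) :
    ∫ z, a z * ((‖𝓕 h (v z)‖ ^ 2 : ℝ) : ℂ) ∂μ =
    ∫ q : E × E, h q.1 * (starRingEnd ℂ) (h q.2) * (∫ z, a z * (Real.fourierChar (-(inner ℝ (q.1 - q.2) (v z))) : ℂ) ∂μ) := by
  have h1 : ∀ z, a z * ((‖𝓕 h (v z)‖ ^ 2 : ℝ) : ℂ) = ∫ q : E × E, a z * (h q.1 * (starRingEnd ℂ) (h q.2) * (Real.fourierChar (-(inner ℝ (q.1 - q.2) (v z))) : ℂ)) := by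
    intro z
    rw [integral_const_mul]
    congr 1
    have e1 : ((‖𝓕 h (v z)‖ ^ 2 : ℝ) : ℂ) = 𝓕 h (v z) * (starRingEnd ℂ) (𝓕 h (v z)) := by
      rw [Complex.mul_conj, Complex.normSq_eq_norm_sq]
    rw [e1, Real.fourier_eq, ← integral_conj, ← integral_prod_mul, ← Measure.volume_eq_prod]
    congr 1 with q
    rw [inner_sub_left, Circle.smul_def, Circle.smul_def, smul_eq_mul, smul_eq_mul, map_mul,
      ← Circle.coe_inv_eq_conj, ← AddChar.map_neg_eq_inv]
    rw [show -(inner ℝ q.1 (v z) - inner ℝ q.2 (v z)) = -inner ℝ q.1 (v z) + - -inner ℝ q.2 (v z) by ring,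
      AddChar.map_add_eq_mul, Circle.coe_mul]
    ring
  simp only [h1]
  rw [integral_integral_swap]
  · congr 1 with q
    rw [← integral_const_mul]
    congr 1 with z
    ring
  · have i1 : Integrable (fun q : E × E => h q.1 * (starRingEnd ℂ) (h q.2)) (volume.prod volume) := by
      have hc : Integrable (fun y => (starRingEnd ℂ) (h y)) := by
        exact (LinearIsometryEquiv.integrable_comp_iff Complex.conjLIE).2 hh
      exact hh.mul_prod hc
    have i2 := ha.mul_prod i1
    have i3 := i2.bdd_mul (c := 1) (f := fun z : Ω × (E × E) => (Real.fourierChar (-(inner ℝ (z.2.1 - z.2.2) (v z.1))) : ℂ)) (by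
      apply Measurable.aestronglyMeasurable
      have : Measurable (fun z : Ω × (E × E) => inner ℝ (z.2.1 - z.2.2) (v z.1)) := by fun_prop
      have hc : Continuous (fun t : ℝ => (Real.fourierChar t : ℂ)) := by fun_prop
      exact hc.measurable.comp this.neg)
      (Filter.Eventually.of_forall fun z => (Circle.norm_coe _).le)
    refine i3.congr (Filter.Eventually.of_forall fun z => ?_)
    simp only [Function.uncurry]
    ring

theorem ennreal_two_mul (a b : ℝ≥0∞) : 2 * (a * b) ≤ a ^ 2 + b ^ 2 := by
  wlog h : a ≤ b generalizing a b
  · have := this b a (le_of_not_ge h)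
    rwa [mul_comm b a, add_comm] at this
  obtain ⟨c, rfl⟩ := exists_add_of_le h
  calc 2 * (a * (a + c)) ≤ 2 * (a * (a + c)) + c ^ 2 := le_self_add
    _ = a ^ 2 + (a + c) ^ 2 := by ring

theorem schur_lemma {X : Type*} [MeasurableSpace X] (ν : Measure X) [SFinite ν] (f : X → ℝ≥0∞) (hf : AEMeasurable f ν)
    (κ : X → X → ℝ≥0∞) (hκ : Measurable (Function.uncurry κ)) (hs : ∀ x y, κ x y = κ y x) (B : ℝ≥0∞)
    (hB : ∀ x, ∫⁻ y, κ x y ∂ν ≤ B) :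
    ∫⁻ x, ∫⁻ y, f x * f y * κ x y ∂ν ∂ν ≤ B * ∫⁻ x, f x ^ 2 ∂ν := by
  have h1 : ∀ x y, 2 * (f x * f y * κ x y) ≤ f x ^ 2 * κ x y + f y ^ 2 * κ x y := by
    intro x y
    rw [← add_mul, ← mul_assoc]
    gcongr
    exact ennreal_two_mul _ _
  have h3 : ∀ x, Measurable (fun y => κ x y) := fun x => by
    exact hκ.comp measurable_prodMk_left
  have hB' : ∫⁻ x, ∫⁻ y, f x ^ 2 * κ x y ∂ν ∂ν ≤ B * ∫⁻ x, f x ^ 2 ∂ν := by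
    rw [← lintegral_const_mul'' _ (hf.pow_const 2)]
    refine lintegral_mono fun x => ?_
    rw [lintegral_const_mul _ (h3 x), mul_comm]
    exact mul_le_mul_left (hB x) _
  have h2 : 2 * ∫⁻ x, ∫⁻ y, f x * f y * κ x y ∂ν ∂ν ≤ 2 * (B * ∫⁻ x, f x ^ 2 ∂ν) := by
    calc 2 * ∫⁻ x, ∫⁻ y, f x * f y * κ x y ∂ν ∂ν = ∫⁻ x, ∫⁻ y, 2 * (f x * f y * κ x y) ∂ν ∂ν := by
          rw [← lintegral_const_mul' _ _ (by simp)]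
          congr 1 with x
          rw [← lintegral_const_mul' _ _ (by simp)]
      _ ≤ ∫⁻ x, ∫⁻ y, (f x ^ 2 * κ x y + f y ^ 2 * κ x y) ∂ν ∂ν := by
          gcongr with x y; exact h1 x y
      _ = ∫⁻ x, ((∫⁻ y, f x ^ 2 * κ x y ∂ν) + ∫⁻ y, f y ^ 2 * κ x y ∂ν) ∂ν := by
          congr 1 with x
          rw [lintegral_add_left ((h3 x).const_mul _)]
      _ = (∫⁻ x, ∫⁻ y, f x ^ 2 * κ x y ∂ν ∂ν) + ∫⁻ x, ∫⁻ y, f y ^ 2 * κ x y ∂ν ∂ν := by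
          rw [lintegral_add_left']
          have : AEMeasurable (fun x => f x ^ 2 * ∫⁻ y, κ x y ∂ν) ν := (hf.pow_const 2).mul (Measurable.lintegral_prod_right hκ).aemeasurable
          refine this.congr (Filter.Eventually.of_forall fun x => ?_)
          simp only
          rw [lintegral_const_mul _ (h3 x)]
      _ = (∫⁻ x, ∫⁻ y, f x ^ 2 * κ x y ∂ν ∂ν) + ∫⁻ y, ∫⁻ x, f y ^ 2 * κ x y ∂ν ∂ν := by
          congr 1
          refine lintegral_lintegral_swap ?_
          exact ((hf.pow_const 2).comp_quasiMeasurePreserving Measure.quasiMeasurePreserving_snd).mul hκ.aemeasurable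
      _ ≤ _ := by
          rw [two_mul]
          refine add_le_add hB' ?_
          refine le_trans (le_of_eq ?_) hB'
          congr 1 with x; congr 1 with y; rw [hs]
  exact (ENNReal.mul_le_mul_iff_right (by simp) (by simp)).1 h2

end Part4

section Part5
open MeasureTheory Metric Complex
open scoped ENNReal FourierTransform SchwartzMap

theorem lintegral_smul_scale {E : Type*} [NormedAddCommGroup E] [InnerProductSpace ℝ E]
    [FiniteDimensional ℝ E] [MeasurableSpace E] [BorelSpace E] (f : E → ℝ≥0∞) (hf : Measurable f) (R : ℝ) (hR : 0 < R) :
    ENNReal.ofReal (R ^ Module.finrank ℝ E) * ∫⁻ x, f (R • x) = ∫⁻ x, f x := by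
  have h := lintegral_map (μ := (volume : Measure E)) hf (measurable_const_smul R)
  rw [Measure.map_addHaar_smul _ hR.ne', lintegral_smul_measure, abs_of_pos (by positivity)] at h
  rw [← h, smul_eq_mul, ← mul_assoc, ← ENNReal.ofReal_mul (by positivity), mul_inv_cancel₀ (by positivity)]
  simp

theorem sph_G {E : Type*} [NormedAddCommGroup E] [InnerProductSpace ℝ E]
    [FiniteDimensional ℝ E] [MeasurableSpace E] [BorelSpace E] [Nontrivial E] :
    ∃ C : ℝ, 0 < C ∧ ∀ R : ℝ, 0 < R → ∀ η : E,
      ENNReal.ofReal (R ^ Module.finrank ℝ E) * ∫⁻ ω : sphere (0:E) 1, ENNReal.ofReal (((1 + ‖R • (η - ω)‖) ^ (Module.finrank ℝ E + 1))⁻¹) ∂(volume : Measure E).toSphere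
        ≤ ENNReal.ofReal (C * R) := by
  set d := Module.finrank ℝ E with hd
  have hInt0 : Integrable (fun x : E => ((1 + ‖x‖) ^ (d + 1))⁻¹) := by
    have := integrable_one_add_norm (E := E) (μ := volume) (r := d + 1) (by rw [← hd]; linarith)
    refine this.congr (Filter.Eventually.of_forall fun x => ?_)
    simp only
    rw [Real.rpow_neg (by positivity)]
    norm_cast
  set I : ℝ := ∫ x : E, ((1 + ‖x‖) ^ (d + 1))⁻¹ with hI
  have hI0 : 0 ≤ I := integral_nonneg fun x => by positivity
  refine ⟨2 ^ (d + 1) * I + 1, by positivity, fun R hR η => ?_⟩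
  set g : E → ℝ≥0∞ := fun x => ENNReal.ofReal (((1 + ‖x‖) ^ (d + 1))⁻¹) with hg
  have hgm : Measurable g := by
    have : Measurable (fun x : E => ((1 + ‖x‖) ^ (d + 1))⁻¹) := by fun_prop
    exact this.ennreal_ofReal
  have hgI : ∫⁻ x, g x = ENNReal.ofReal I := by
    rw [hI, ofReal_integral_eq_lintegral_ofReal hInt0 (Filter.Eventually.of_forall fun x => by positivity)]
  have h1 : ∫⁻ ζ, g (R • (η - ζ)) = ∫⁻ ζ, g (R • ζ) := by
    exact lintegral_sub_left_eq_self (fun ζ => g (R • ζ)) η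
  have h2 := lintegral_smul_scale g hgm R hR
  have h3 := lintegral_polar (fun ζ => g (R • (η - ζ))) (by fun_prop)
  have h4 : ∀ ω : sphere (0:E) 1, g (R • (η - ω)) * ENNReal.ofReal (1 / R) ≤
      2 ^ (d + 1) * ∫⁻ r in Set.Ioi (0:ℝ), ENNReal.ofReal (r^(Module.finrank ℝ E - 1)) * g (R • (η - (r • (ω:E)))) := by
    intro ω
    have : g (R • (η - ω)) * ENNReal.ofReal (1 / R) = ∫⁻ r in Set.Ioo (1:ℝ) (1 + 1 / R), g (R • (η - ω)) := by
      rw [setLIntegral_const, Real.volume_Ioo]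
      congr 2; ring
    rw [this, ← lintegral_const_mul' _ _ (by simp)]
    refine le_trans ?_ (lintegral_mono_set (s := Set.Ioo (1:ℝ) (1 + 1 / R)) (fun r hr => lt_trans one_pos hr.1))
    refine setLIntegral_mono (by fun_prop) fun r hr => ?_
    have a1 : 1 ≤ ENNReal.ofReal (r^(Module.finrank ℝ E - 1)) := by
      rw [← ENNReal.ofReal_one]
      exact ENNReal.ofReal_le_ofReal (one_le_pow₀ hr.1.le)
    have a2 : g (R • (η - ω)) ≤ 2 ^ (d + 1) * g (R • (η - (r • (ω:E)))) := by
      simp only [hg]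
      rw [show (2:ℝ≥0∞) ^ (d + 1) = ENNReal.ofReal (2 ^ (d + 1)) by rw [ENNReal.ofReal_pow (by norm_num)]; norm_num,
        ← ENNReal.ofReal_mul (by positivity)]
      apply ENNReal.ofReal_le_ofReal
      rw [← div_eq_mul_inv, inv_le_iff_one_le_mul₀ (by positivity), div_mul_eq_mul_div, one_le_div (by positivity), ← mul_pow]
      gcongr
      have : ‖R • (η - r • (ω:E))‖ ≤ ‖R • (η - ω)‖ + 1 := by
        have e1 : R • (η - r • (ω:E)) = R • (η - ω) - (R * (r - 1)) • (ω:E) := by module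
        rw [e1]
        refine (norm_sub_le _ _).trans ?_
        gcongr
        rw [norm_smul, Real.norm_of_nonneg (mul_nonneg hR.le (by linarith [hr.1]))]
        have h5 : r - 1 ≤ 1 / R := by linarith [hr.2]
        have : ‖(ω:E)‖ = 1 := by simp
        rw [this, mul_one]
        calc R * (r - 1) ≤ R * (1 / R) := by gcongr
          _ = 1 := by field_simp
      have := norm_nonneg (R • (η - (ω:E)))
      linarith
    calc g (R • (η - ω)) ≤ 2 ^ (d + 1) * g (R • (η - (r • (ω:E)))) := a2
      _ = 2 ^ (d + 1) * (1 * g (R • (η - (r • (ω:E))))) := by rw [one_mul]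
      _ ≤ _ := by gcongr
  have h5 : (∫⁻ ω : sphere (0:E) 1, g (R • (η - ω)) ∂(volume : Measure E).toSphere) * ENNReal.ofReal (1 / R) ≤ 2 ^ (d + 1) * ∫⁻ ζ, g (R • ζ) := by
    rw [← h1, h3, ← lintegral_mul_const' _ _ (by simp), ← lintegral_const_mul' _ _ (by simp)]
    exact lintegral_mono h4
  have h6 : ENNReal.ofReal (R ^ d) * ((∫⁻ ω : sphere (0:E) 1, g (R • (η - ω)) ∂(volume : Measure E).toSphere) * ENNReal.ofReal (1 / R)) ≤ ENNReal.ofReal (2 ^ (d + 1) * I + 1) := by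
    calc _ ≤ ENNReal.ofReal (R ^ d) * (2 ^ (d + 1) * ∫⁻ ζ, g (R • ζ)) := by gcongr
      _ = 2 ^ (d + 1) * (ENNReal.ofReal (R ^ d) * ∫⁻ ζ, g (R • ζ)) := by ring
      _ = ENNReal.ofReal (2 ^ (d + 1) * I) := by
        rw [h2, hgI, ENNReal.ofReal_mul (by positivity), ENNReal.ofReal_pow (by norm_num)]; norm_num
      _ ≤ _ := ENNReal.ofReal_le_ofReal (by linarith)
  calc _ = ENNReal.ofReal (R ^ d) * ((∫⁻ ω : sphere (0:E) 1, g (R • (η - ω)) ∂(volume : Measure E).toSphere) * ENNReal.ofReal (1 / R)) * ENNReal.ofReal R := by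
        rw [mul_assoc, mul_assoc, ← ENNReal.ofReal_mul (by positivity), one_div, inv_mul_cancel₀ hR.ne']; simp [hg]
    _ ≤ _ := by
      rw [ENNReal.ofReal_mul (by positivity)]
      gcongr

theorem low_part {E : Type*} [NormedAddCommGroup E] [InnerProductSpace ℝ E]
    [FiniteDimensional ℝ E] [MeasurableSpace E] [BorelSpace E] [Nontrivial E] (ψ : 𝓢(E, ℂ)) :
    ∃ C : ℝ, 0 < C ∧ ∀ R : ℝ, 0 < R → ∀ h : E → ℂ, Integrable h →
      ‖∫ q : E × E, h q.1 * (starRingEnd ℂ) (h q.2) * (sphK (q.1 - q.2) * 𝓕 (ψ : E → ℂ) (R⁻¹ • (q.1 - q.2)))‖ₑ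
        ≤ ENNReal.ofReal (C * R) * ∫⁻ η, ‖𝓕 h η‖ₑ ^ 2 := by
  obtain ⟨C, hC, hG⟩ := sph_G (E := E)
  set d := Module.finrank ℝ E with hd
  set σ := (volume : Measure E).toSphere
  obtain ⟨D, hD, hψ⟩ : ∃ D : ℝ, 0 < D ∧ ∀ x, ‖ψ x‖ ≤ D * ((1 + ‖x‖) ^ (d + 1))⁻¹ := by
    refine ⟨2 ^ (d + 1) * (Finset.Iic (d + 1, 0)).sup (fun m => SchwartzMap.seminorm ℝ m.1 m.2) ψ + 1, by positivity, fun x => ?_⟩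
    have := SchwartzMap.one_add_le_sup_seminorm_apply (𝕜 := ℝ) (m := (d + 1, 0)) (k := d + 1) (n := 0) le_rfl le_rfl ψ x
    rw [norm_iteratedFDeriv_zero] at this
    rw [← div_eq_mul_inv, le_div_iff₀ (by positivity)]
    simp only at this
    linarith
  refine ⟨D * C, by positivity, fun R hR h hh => ?_⟩
  let a : sphere (0:E) 1 × E → ℂ := fun z => ((R ^ d : ℝ) : ℂ) * ψ (R • (z.2 - z.1))
  have hac : Continuous a := by
    have := ψ.continuous
    fun_prop
  have haI : Integrable a (σ.prod volume) := by
    rw [integrable_prod_iff hac.aestronglyMeasurable]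
    constructor
    · refine Filter.Eventually.of_forall fun ω => ?_
      exact ((ψ.integrable.comp_smul hR.ne').comp_sub_right (ω:E)).const_mul _
    · refine (integrable_const (∫ y, ‖((R ^ d : ℝ) : ℂ) * ψ (R • y)‖)).congr (Filter.Eventually.of_forall fun ω => ?_)
      simp only [a]
      exact (integral_sub_right_eq_self (fun y => ‖((R ^ d : ℝ) : ℂ) * ψ (R • y)‖) (ω:E)).symm
  have key := tt_star (σ.prod volume) a haI (fun z => z.2) measurable_snd h hh
  have hker : ∀ x : E, ∫ z, a z * (Real.fourierChar (-(inner ℝ x z.2)) : ℂ) ∂(σ.prod volume) = sphK x * 𝓕 (ψ : E → ℂ) (R⁻¹ • x) := by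
    intro x
    have hi : Integrable (fun z : sphere (0:E) 1 × E => a z * (Real.fourierChar (-(inner ℝ x z.2)) : ℂ)) (σ.prod volume) := by
      refine haI.mul_bdd (c := 1) (Continuous.aestronglyMeasurable (by fun_prop)) (Filter.Eventually.of_forall fun z => (Circle.norm_coe _).le)
    rw [integral_prod _ hi]
    unfold sphK
    rw [← integral_mul_const]
    congr 1 with ω
    simp only [a]
    have e1 := integral_sub_right_eq_self (μ := (volume : Measure E)) (fun y => ((R ^ d : ℝ) : ℂ) * ψ (R • y) * (Real.fourierChar (-(inner ℝ x (y + ω))) : ℂ)) (ω:E)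
    simp only [sub_add_cancel] at e1
    rw [e1]
    have e2 := Measure.integral_comp_smul (volume : Measure E) (fun y => ((R ^ d : ℝ) : ℂ) * ψ y * (Real.fourierChar (-(inner ℝ x (R⁻¹ • y + ω))) : ℂ)) R
    simp only [smul_smul, inv_mul_cancel₀ hR.ne', one_smul] at e2
    rw [e2, Real.fourier_eq, ← integral_const_mul, ← integral_smul]
    congr 1 with y
    rw [inner_add_right, neg_add, AddChar.map_add_eq_mul, Circle.coe_mul, Circle.smul_def, real_inner_smul_right, real_inner_comm, ← real_inner_smul_right, abs_of_pos (by positivity), Complex.real_smul, ← hd]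
    push_cast
    have : (R:ℂ) ^ d ≠ 0 := by simp [hR.ne']
    field_simp
    rw [smul_eq_mul]; ring
  simp only [hker] at key
  rw [← key]
  refine (enorm_integral_le_lintegral_enorm _).trans ?_
  have hcF : Continuous (𝓕 h) := VectorFourier.fourierIntegral_continuous Real.continuous_fourierChar (by exact continuous_inner) hh
  have hmeas : Measurable (fun z : sphere (0:E) 1 × E => ‖a z * ((‖𝓕 h z.2‖ ^ 2 : ℝ) : ℂ)‖ₑ) := by
    apply Continuous.measurable
    fun_prop
  rw [lintegral_prod_symm' _ hmeas, ← lintegral_const_mul' _ _ (by simp)]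
  refine lintegral_mono fun η => ?_
  simp only
  calc ∫⁻ ω, ‖a (ω, η) * ((‖𝓕 h η‖ ^ 2 : ℝ) : ℂ)‖ₑ ∂σ
      = ∫⁻ ω, ‖a (ω, η)‖ₑ * ‖𝓕 h η‖ₑ ^ 2 ∂σ := by
        congr 1 with ω
        have e3 : ‖((‖𝓕 h η‖ : ℝ) : ℂ)‖ₑ = ‖𝓕 h η‖ₑ := by
          rw [← ofReal_norm, Complex.norm_real, norm_norm, ofReal_norm]
        rw [enorm_mul, Complex.ofReal_pow, enorm_pow, e3]
    _ = (∫⁻ ω, ‖a (ω, η)‖ₑ ∂σ) * ‖𝓕 h η‖ₑ ^ 2 := by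
        rw [lintegral_mul_const' _ _ (by simp)]
    _ ≤ _ := by
        gcongr
        calc ∫⁻ ω, ‖a (ω, η)‖ₑ ∂σ ≤ ∫⁻ ω : sphere (0:E) 1, ENNReal.ofReal D * (ENNReal.ofReal (R ^ d) * ENNReal.ofReal (((1 + ‖R • (η - (ω:E))‖) ^ (d + 1))⁻¹)) ∂σ := by
              refine lintegral_mono fun ω => ?_
              simp only [a]
              rw [← ENNReal.ofReal_mul (by positivity), ← ENNReal.ofReal_mul (by positivity), ← ofReal_norm]
              apply ENNReal.ofReal_le_ofReal
              rw [norm_mul, Complex.norm_real, Real.norm_of_nonneg (by positivity)]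
              have := hψ (R • (η - ω))
              calc _ ≤ R ^ d * (D * ((1 + ‖R • (η - (ω:E))‖) ^ (d + 1))⁻¹) := by gcongr
                _ = _ := by ring
          _ = ENNReal.ofReal D * (ENNReal.ofReal (R ^ d) * ∫⁻ ω : sphere (0:E) 1, ENNReal.ofReal (((1 + ‖R • (η - (ω:E))‖) ^ (d + 1))⁻¹) ∂σ) := by
              rw [lintegral_const_mul' _ _ (by simp), lintegral_const_mul' _ _ (by simp)]
          _ ≤ ENNReal.ofReal D * ENNReal.ofReal (C * R) := by
              gcongr; exact hG R hR η
          _ = _ := by rw [← ENNReal.ofReal_mul hD.le]; congr 1; ring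

end Part5

section Part6
open MeasureTheory Metric Complex
open scoped ENNReal FourierTransform SchwartzMap

theorem exists_cutoff {E : Type*} [NormedAddCommGroup E] [InnerProductSpace ℝ E]
    [FiniteDimensional ℝ E] [MeasurableSpace E] [BorelSpace E] :
    ∃ ψ : 𝓢(E, ℂ), (∀ x, ‖1 - 𝓕 (ψ : E → ℂ) x‖ ≤ 1) ∧ ∀ x, ‖x‖ ≤ 1 → 𝓕 (ψ : E → ℂ) x = 1 := by
  let b : ContDiffBump (0 : E) := ⟨1, 2, by norm_num, by norm_num⟩
  have h1 : HasCompactSupport (fun x => ((b x : ℝ) : ℂ)) := b.hasCompactSupport.comp_left (g := fun t : ℝ => (t : ℂ)) (by simp)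
  have h2 : ContDiff ℝ (↑(⊤:ℕ∞)) (fun x => ((b x : ℝ) : ℂ)) := Complex.ofRealCLM.contDiff.comp b.contDiff
  let χ : 𝓢(E, ℂ) := h1.toSchwartzMap h2
  have hχ : ∀ x, χ x = ((b x : ℝ) : ℂ) := fun x => rfl
  have h3 : ∀ x, 𝓕 ((𝓕⁻ χ : 𝓢(E, ℂ)) : E → ℂ) x = χ x := by
    intro x
    rw [← SchwartzMap.fourier_coe, FourierTransform.fourier_fourierInv_eq]
  refine ⟨𝓕⁻ χ, fun x => ?_, fun x hx => ?_⟩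
  · rw [h3, hχ, ← Complex.ofReal_one, ← Complex.ofReal_sub, Complex.norm_real, Real.norm_of_nonneg (by linarith [b.le_one (x := x)])]
    linarith [b.nonneg (x := x)]
  · rw [h3, hχ, b.one_of_mem_closedBall (by simpa using hx)]
    simp

theorem energy {E : Type*} [NormedAddCommGroup E] [InnerProductSpace ℝ E]
    [FiniteDimensional ℝ E] [MeasurableSpace E] [BorelSpace E] [Nontrivial E] :
    ∃ C : ℝ, 0 < C ∧ ∀ R : ℝ, 0 < R → ∀ A : Set E, MeasurableSet A → ∀ B : ℝ≥0∞,
      (∀ x : E, ∫⁻ y in A, (if R ≤ ‖x - y‖ then ‖sphK (x - y)‖ₑ else 0) ≤ B) →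
      ∀ h : E → ℂ, Integrable h → MemLp h 2 volume → (∀ x, x ∉ A → h x = 0) →
      ∫⁻ ω : sphere (0:E) 1, ‖𝓕 h ω‖ₑ ^ 2 ∂(volume : Measure E).toSphere ≤ (ENNReal.ofReal (C * R) + B) * ∫⁻ x, ‖h x‖ₑ ^ 2 := by
  obtain ⟨ψ, hψ1, hψ2⟩ := exists_cutoff (E := E)
  obtain ⟨C, hC, hlow⟩ := low_part ψ
  refine ⟨C, hC, fun R hR A hA B hB h hh hh2 hsupp => ?_⟩
  set σ := (volume : Measure E).toSphere
  have hcF : Continuous (𝓕 h) := VectorFourier.fourierIntegral_continuous Real.continuous_fourierChar (by exact continuous_inner) hh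
  have hcψ : Continuous (𝓕 (ψ : E → ℂ)) := VectorFourier.fourierIntegral_continuous Real.continuous_fourierChar (by exact continuous_inner) ψ.integrable
  have hcK := sphK_cont (E := E)
  obtain ⟨D, hD, hKD, -⟩ := sphK_decay (E := E)
  have hl := hlow R hR h hh
  rw [plancherel_lintegral hh hh2] at hl
  have key := tt_star σ (fun _ => 1) (integrable_const _) (fun ω => (ω:E)) measurable_subtype_coe h hh
  simp only [one_mul] at key
  have e1 : ‖∫ ω : sphere (0:E) 1, ((‖𝓕 h ω‖ ^ 2 : ℝ) : ℂ) ∂σ‖ₑ = ∫⁻ ω : sphere (0:E) 1, ‖𝓕 h ω‖ₑ ^ 2 ∂σ := by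
    rw [integral_complex_ofReal, ← ofReal_norm, Complex.norm_real, Real.norm_of_nonneg (integral_nonneg fun ω => by positivity),
      ofReal_integral_eq_lintegral_ofReal]
    · congr 1 with ω
      rw [ENNReal.ofReal_pow (norm_nonneg _), ofReal_norm]
    · exact Continuous.integrable_of_hasCompactSupport (by fun_prop) (HasCompactSupport.of_compactSpace _)
    · exact Filter.Eventually.of_forall fun ω => by positivity
  rw [← e1, key]
  have i1 : Integrable (fun q : E × E => h q.1 * (starRingEnd ℂ) (h q.2)) (volume.prod volume) := by
    have hc : Integrable (fun y => (starRingEnd ℂ) (h y)) :=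
      (LinearIsometryEquiv.integrable_comp_iff Complex.conjLIE).2 hh
    exact hh.mul_prod hc
  rw [← Measure.volume_eq_prod] at i1
  have hF1 : ∀ x, ‖𝓕 (ψ : E → ℂ) x‖ ≤ 2 := by
    intro x
    calc ‖𝓕 (ψ : E → ℂ) x‖ = ‖1 - (1 - 𝓕 (ψ : E → ℂ) x)‖ := by congr 1; ring
      _ ≤ ‖(1:ℂ)‖ + ‖1 - 𝓕 (ψ : E → ℂ) x‖ := norm_sub_le _ _
      _ ≤ 2 := by rw [norm_one]; linarith [hψ1 x]
  have i2 : Integrable (fun q : E × E => h q.1 * (starRingEnd ℂ) (h q.2) * (sphK (q.1 - q.2) * 𝓕 (ψ : E → ℂ) (R⁻¹ • (q.1 - q.2)))) := by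
    refine i1.mul_bdd (c := D * 2) (Continuous.aestronglyMeasurable (by fun_prop)) (Filter.Eventually.of_forall fun q => ?_)
    rw [norm_mul]
    exact mul_le_mul (hKD _) (hF1 _) (norm_nonneg _) hD.le
  have i3 : Integrable (fun q : E × E => h q.1 * (starRingEnd ℂ) (h q.2) * (sphK (q.1 - q.2) * (1 - 𝓕 (ψ : E → ℂ) (R⁻¹ • (q.1 - q.2))))) := by
    refine i1.mul_bdd (c := D * 1) (Continuous.aestronglyMeasurable (by fun_prop)) (Filter.Eventually.of_forall fun q => ?_)
    rw [norm_mul]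
    exact mul_le_mul (hKD _) (hψ1 _) (norm_nonneg _) hD.le
  have e2 : ∫ q : E × E, h q.1 * (starRingEnd ℂ) (h q.2) * (∫ ω : sphere (0:E) 1, (Real.fourierChar (-(inner ℝ (q.1 - q.2) (ω:E))) : ℂ) ∂σ)
      = (∫ q : E × E, h q.1 * (starRingEnd ℂ) (h q.2) * (sphK (q.1 - q.2) * 𝓕 (ψ : E → ℂ) (R⁻¹ • (q.1 - q.2))))
      + ∫ q : E × E, h q.1 * (starRingEnd ℂ) (h q.2) * (sphK (q.1 - q.2) * (1 - 𝓕 (ψ : E → ℂ) (R⁻¹ • (q.1 - q.2)))) := by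
    rw [← integral_add i2 i3]
    congr 1 with q
    rw [show (∫ ω : sphere (0:E) 1, (Real.fourierChar (-(inner ℝ (q.1 - q.2) (ω:E))) : ℂ) ∂σ) = sphK (q.1 - q.2) from rfl]
    ring
  rw [e2, add_mul]
  refine (enorm_add_le _ _).trans (add_le_add hl ?_)
  set κ : E → E → ℝ≥0∞ := fun x y => if R ≤ ‖x - y‖ then ‖sphK (x - y)‖ₑ else 0 with hκ
  have hκm : Measurable (Function.uncurry κ) := by
    refine Measurable.ite (measurableSet_le measurable_const (by fun_prop)) ?_ measurable_const
    apply Continuous.measurable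
    fun_prop
  have hκs : ∀ x y, κ x y = κ y x := by
    intro x y
    simp only [hκ]
    rw [norm_sub_rev x y, ← neg_sub y x, sphK_neg]
  have hae : AEMeasurable (fun x => ‖h x‖ₑ) := hh.aestronglyMeasurable.enorm
  have hsch := schur_lemma (volume.restrict A) (fun x => ‖h x‖ₑ) hae.restrict κ hκm hκs B hB
  have hres : ∀ F : E → ℝ≥0∞, (∀ x, x ∉ A → F x = 0) → ∫⁻ x in A, F x = ∫⁻ x, F x := by
    intro F hF
    rw [← lintegral_indicator hA]
    congr 1
    apply Set.indicator_eq_self.2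
    intro x hx
    by_contra hc
    exact hx (hF x hc)
  calc _ ≤ ∫⁻ q : E × E, ‖h q.1‖ₑ * ‖h q.2‖ₑ * κ q.1 q.2 := by
        refine (enorm_integral_le_lintegral_enorm _).trans (lintegral_mono fun q => ?_)
        simp only
        rw [enorm_mul, enorm_mul]
        have : ‖(starRingEnd ℂ) (h q.2)‖ₑ = ‖h q.2‖ₑ := by
          rw [← ofReal_norm, RCLike.norm_conj, ofReal_norm]
        rw [this]
        gcongr
        simp only [hκ]
        split_ifs with hc
        · rw [enorm_mul]
          calc _ ≤ ‖sphK (q.1 - q.2)‖ₑ * 1 := by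
                gcongr
                rw [← ofReal_norm, ← ENNReal.ofReal_one]
                exact ENNReal.ofReal_le_ofReal (hψ1 _)
            _ = _ := mul_one _
        · rw [hψ2]
          · simp
          · rw [norm_smul, norm_inv, Real.norm_of_nonneg hR.le, inv_mul_le_iff₀ hR]
            linarith
    _ = ∫⁻ x, ∫⁻ y, ‖h x‖ₑ * ‖h y‖ₑ * κ x y := by
        rw [Measure.volume_eq_prod, lintegral_prod]
        have m1 : AEMeasurable (fun q : E × E => ‖h q.1‖ₑ) (volume.prod volume) :=
          hae.comp_quasiMeasurePreserving Measure.quasiMeasurePreserving_fst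
        have m2 : AEMeasurable (fun q : E × E => ‖h q.2‖ₑ) (volume.prod volume) :=
          hae.comp_quasiMeasurePreserving Measure.quasiMeasurePreserving_snd
        exact (m1.mul m2).mul hκm.aemeasurable
    _ = ∫⁻ x in A, ∫⁻ y in A, ‖h x‖ₑ * ‖h y‖ₑ * κ x y := by
        rw [hres]
        · congr 1 with x
          rw [hres]
          intro y hy
          rw [hsupp y hy]; simp
        · intro x hx
          rw [hsupp x hx]; simp
    _ ≤ _ := hsch
    _ = _ := by
        rw [hres]
        intro x hx
        rw [hsupp x hx]; simp

end Part6

section Part7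
open MeasureTheory Metric Complex
open scoped ENNReal FourierTransform SchwartzMap

theorem high_part {E : Type*} [NormedAddCommGroup E] [InnerProductSpace ℝ E]
    [FiniteDimensional ℝ E] [MeasurableSpace E] [BorelSpace E] [Nontrivial E] (p : ℝ)
    (hp : ((Module.finrank ℝ E : ℝ) + 1) / 4 < p) :
    ∃ C : ℝ, 0 < C ∧ ∀ (A : Set E) (Q : ℝ), 0 ≤ Q →
      (∀ (x : E) (r : ℝ), 0 < r → volume (A ∩ ball x r) ≤ ENNReal.ofReal (Q * r ^ ((Module.finrank ℝ E : ℝ) - 2 * p))) →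
      ∀ T : ℝ, 1 ≤ T → ∀ x : E, ∫⁻ y in A, (if T ≤ ‖x - y‖ then ‖sphK (x - y)‖ₑ else 0)
        ≤ ENNReal.ofReal (C * Q * T ^ (((Module.finrank ℝ E : ℝ) + 1) / 2 - 2 * p)) := by
  obtain ⟨D, hD, -, hK⟩ := sphK_decay (E := E)
  set d : ℝ := (Module.finrank ℝ E : ℝ) with hd
  set β : ℝ := (d + 1) / 2 - 2 * p with hβ
  have hβ0 : β < 0 := by linarith
  have hq1 : (2:ℝ) ^ β < 1 := Real.rpow_lt_one_of_one_lt_of_neg (by norm_num) hβ0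
  have hq0 : (0:ℝ) < 2 ^ β := by positivity
  have hd1 : 1 ≤ d := by
    have : 1 ≤ Module.finrank ℝ E := Module.finrank_pos
    rw [hd]; exact_mod_cast this
  refine ⟨D * 2 ^ (d - 2 * p) * (1 - 2 ^ β)⁻¹, ?_, fun A Q hQ hA T hT x => ?_⟩
  · have : 0 < 1 - (2:ℝ) ^ β := by linarith
    positivity
  have hT0 : 0 < T := by linarith
  calc ∫⁻ y in A, (if T ≤ ‖x - y‖ then ‖sphK (x - y)‖ₑ else 0)
      ≤ ∫⁻ y in A, ∑' j : ℕ, (ball x (2 ^ (j + 1) * T)).indicator (fun _ => ENNReal.ofReal (D * (2 ^ j * T) ^ (-(d - 1) / 2))) y := by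
        refine lintegral_mono fun y => ?_
        simp only
        split_ifs with hc
        · obtain ⟨j, hj1, hj2⟩ := exists_nat_pow_near (x := ‖x - y‖ / T) (y := 2) (by rwa [one_le_div hT0]) (by norm_num)
          rw [le_div_iff₀ hT0] at hj1
          rw [div_lt_iff₀ hT0] at hj2
          refine le_trans ?_ (ENNReal.le_tsum j)
          rw [Set.indicator_of_mem (by rw [mem_ball, dist_comm, dist_eq_norm]; exact hj2), ← ofReal_norm]
          apply ENNReal.ofReal_le_ofReal
          refine (hK _ (hT.trans hc)).trans ?_
          gcongr ?_ * ?_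
          apply Real.rpow_le_rpow_of_nonpos (by positivity) hj1
          linarith
        · exact zero_le
    _ = ∑' j : ℕ, ∫⁻ y in A, (ball x (2 ^ (j + 1) * T)).indicator (fun _ => ENNReal.ofReal (D * (2 ^ j * T) ^ (-(d - 1) / 2))) y := by
        rw [lintegral_tsum]
        intro j
        exact (measurable_const.indicator measurableSet_ball).aemeasurable
    _ ≤ ∑' j : ℕ, ENNReal.ofReal ((D * 2 ^ (d - 2 * p) * Q * T ^ β) * (2 ^ β) ^ j) := by
        refine ENNReal.tsum_le_tsum fun j => ?_
        rw [lintegral_indicator measurableSet_ball, setLIntegral_const, Measure.restrict_apply measurableSet_ball, Set.inter_comm]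
        refine (mul_le_mul_right (hA x _ (by positivity)) _).trans ?_
        rw [← ENNReal.ofReal_mul (by positivity)]
        apply ENNReal.ofReal_le_ofReal
        apply le_of_eq
        have e1 : (2:ℝ) ^ (j + 1) * T = 2 * (2 ^ j * T) := by ring
        have e2 : (2 ^ j * T) ^ (-(d - 1) / 2) * (2 ^ j * T) ^ (d - 2 * p) = T ^ β * (2 ^ β) ^ j := by
          rw [← Real.rpow_add (by positivity), show -(d - 1) / 2 + (d - 2 * p) = β by rw [hβ]; ring,
            Real.mul_rpow (by positivity) hT0.le, ← Real.rpow_natCast, ← Real.rpow_natCast, ← Real.rpow_mul (by norm_num),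
            ← Real.rpow_mul (by norm_num), mul_comm (j:ℝ) β, mul_comm]
        rw [e1, Real.mul_rpow (x := 2) (y := 2 ^ j * T) (by norm_num) (by positivity)]
        calc _ = D * 2 ^ (d - 2 * p) * Q * ((2 ^ j * T) ^ (-(d - 1) / 2) * (2 ^ j * T) ^ (d - 2 * p)) := by ring
          _ = _ := by rw [e2]; ring
    _ = ENNReal.ofReal (∑' j : ℕ, (D * 2 ^ (d - 2 * p) * Q * T ^ β) * (2 ^ β) ^ j) := by
        rw [ENNReal.ofReal_tsum_of_nonneg]
        · intro j; positivity
        · exact (summable_geometric_of_lt_one hq0.le hq1).mul_left _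
    _ = _ := by
        rw [tsum_mul_left, tsum_geometric_of_lt_one hq0.le hq1]
        congr 1; ring

theorem high_part_one {E : Type*} [NormedAddCommGroup E] [InnerProductSpace ℝ E]
    [FiniteDimensional ℝ E] [MeasurableSpace E] [BorelSpace E] [Nontrivial E] (p : ℝ)
    (hp : ((Module.finrank ℝ E : ℝ) + 1) / 4 < p) :
    ∃ C : ℝ, 0 < C ∧ ∀ (A : Set E) (Q : ℝ), 0 ≤ Q →
      (∀ (x : E) (r : ℝ), 0 < r → volume (A ∩ ball x r) ≤ ENNReal.ofReal (Q * r ^ ((Module.finrank ℝ E : ℝ) - 2 * p))) →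
      ∀ T : ℝ, ∀ x : E, ∫⁻ y in A, (if T ≤ ‖x - y‖ then ‖sphK (x - y)‖ₑ else 0)
        ≤ ENNReal.ofReal (C * Q) := by
  obtain ⟨C, hC, h⟩ := high_part (E := E) p hp
  obtain ⟨D, hD, hK, -⟩ := sphK_decay (E := E)
  refine ⟨D + C, by positivity, fun A Q hQ hA T x => ?_⟩
  have h1 := h A Q hQ hA 1 le_rfl x
  rw [Real.one_rpow, mul_one] at h1
  calc ∫⁻ y in A, (if T ≤ ‖x - y‖ then ‖sphK (x - y)‖ₑ else 0)
      ≤ ∫⁻ y in A, ((ball x 1).indicator (fun _ => ENNReal.ofReal D) y + (if 1 ≤ ‖x - y‖ then ‖sphK (x - y)‖ₑ else 0)) := by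
        refine lintegral_mono fun y => ?_
        simp only
        split_ifs with hc h1
        · exact le_add_self
        · rw [Set.indicator_of_mem (by rw [mem_ball, dist_comm, dist_eq_norm]; exact not_le.1 h1), ← ofReal_norm]
          exact (ENNReal.ofReal_le_ofReal (hK _)).trans le_self_add
        · exact zero_le
        · exact zero_le
    _ = (∫⁻ y in A, (ball x 1).indicator (fun _ => ENNReal.ofReal D) y) + ∫⁻ y in A, (if 1 ≤ ‖x - y‖ then ‖sphK (x - y)‖ₑ else 0) := by
        rw [lintegral_add_left]
        exact measurable_const.indicator measurableSet_ball
    _ ≤ ENNReal.ofReal (D * Q) + ENNReal.ofReal (C * Q) := by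
        refine add_le_add ?_ h1
        rw [lintegral_indicator measurableSet_ball, setLIntegral_const, Measure.restrict_apply measurableSet_ball, Set.inter_comm]
        refine (mul_le_mul_right (hA x _ one_pos) _).trans ?_
        rw [← ENNReal.ofReal_mul (by positivity), Real.one_rpow, mul_one]
    _ = _ := by rw [← ENNReal.ofReal_add (by positivity) (by positivity)]; congr 1; ring

theorem energy_level {E : Type*} [NormedAddCommGroup E] [InnerProductSpace ℝ E]
    [FiniteDimensional ℝ E] [MeasurableSpace E] [BorelSpace E] [Nontrivial E] (p : ℝ)
    (hd3 : 3 ≤ Module.finrank ℝ E) (hp : ((Module.finrank ℝ E : ℝ) - 1) / 2 < p) :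
    ∃ a < (1:ℝ), ∃ C : ℝ, 0 < C ∧ ∀ (A : Set E), MeasurableSet A → ∀ l : ℝ, 0 < l →
      (∀ (x : E) (r : ℝ), 0 < r → volume (A ∩ ball x r) ≤ ENNReal.ofReal (l ^ (-p) * r ^ ((Module.finrank ℝ E : ℝ) - 2 * p))) →
      ∀ h : E → ℂ, Integrable h → MemLp h 2 volume → (∀ x, x ∉ A → h x = 0) →
      ∫⁻ ω : sphere (0:E) 1, ‖𝓕 h ω‖ₑ ^ 2 ∂(volume : Measure E).toSphere
        ≤ ENNReal.ofReal (C * (if 1 ≤ l then l ^ (-p) else l ^ (-a))) * ∫⁻ x, ‖h x‖ₑ ^ 2 := by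
  have hd3' : (3:ℝ) ≤ (Module.finrank ℝ E : ℝ) := by exact_mod_cast hd3
  have hp4 : ((Module.finrank ℝ E : ℝ) + 1) / 4 < p := by linarith
  obtain ⟨C0, hC0, h0⟩ := energy (E := E)
  obtain ⟨C1, hC1, h1⟩ := high_part (E := E) p hp4
  obtain ⟨C2, hC2, h2⟩ := high_part_one (E := E) p hp4
  set d : ℝ := (Module.finrank ℝ E : ℝ) with hd
  have hden : 0 < 2 * p - (d - 1) / 2 := by linarith
  have hp0 : 0 < p := by linarith
  set a := p / (2 * p - (d - 1) / 2) with ha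
  have ha0 : 0 < a := by positivity
  refine ⟨a, by rw [ha, div_lt_one hden]; linarith, C0 + C1 + C2, by positivity, fun A hA l hl hvol h hh hh2 hs => ?_⟩
  split_ifs with hc
  · refine (h0 (l ^ (-p)) (by positivity) A hA _ (fun x => h2 A (l ^ (-p)) (by positivity) hvol (l ^ (-p)) x) h hh hh2 hs).trans ?_
    gcongr
    rw [← ENNReal.ofReal_add (by positivity) (by positivity)]
    apply ENNReal.ofReal_le_ofReal
    have : 0 ≤ l ^ (-p) := by positivity
    nlinarith
  · have hl1 : l ≤ 1 := by linarith
    have hR : 1 ≤ l ^ (-a) := Real.one_le_rpow_of_pos_of_le_one_of_nonpos hl hl1 (by linarith)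
    refine (h0 (l ^ (-a)) (by positivity) A hA _ (fun x => h1 A (l ^ (-p)) (by positivity) hvol (l ^ (-a)) hR x) h hh hh2 hs).trans ?_
    gcongr
    rw [← ENNReal.ofReal_add (by positivity) (by positivity)]
    apply ENNReal.ofReal_le_ofReal
    have e1 : l ^ (-p) * (l ^ (-a)) ^ ((d + 1) / 2 - 2 * p) = l ^ (-a) := by
      rw [← Real.rpow_mul hl.le, ← Real.rpow_add hl]
      congr 1
      have hap : a * (2 * p - (d - 1) / 2) = p := div_mul_cancel₀ _ hden.ne'
      linear_combination hap
    rw [mul_assoc C1, e1]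
    have : 0 ≤ l ^ (-a) := by positivity
    nlinarith

end Part7

section Part8
open MeasureTheory Metric Complex
open scoped ENNReal FourierTransform SchwartzMap

/-- the extension operator -/
noncomputable def extOp {E : Type*} [NormedAddCommGroup E] [InnerProductSpace ℝ E]
    [FiniteDimensional ℝ E] [MeasurableSpace E] [BorelSpace E] (f : sphere (0:E) 1 → ℂ) (x : E) : ℂ :=
  ∫ ω : sphere (0:E) 1, f ω * (Real.fourierChar (inner ℝ x (ω:E)) : ℂ) ∂(volume : Measure E).toSphere

theorem sph_cont_int {E : Type*} [NormedAddCommGroup E] [InnerProductSpace ℝ E]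
    [FiniteDimensional ℝ E] [MeasurableSpace E] [BorelSpace E] {F : Type*} [NormedAddCommGroup F] (f : sphere (0:E) 1 → F) (hf : Continuous f) :
    Integrable f (volume : Measure E).toSphere :=
  hf.integrable_of_hasCompactSupport (HasCompactSupport.of_compactSpace _)

theorem extOp_cont {E : Type*} [NormedAddCommGroup E] [InnerProductSpace ℝ E]
    [FiniteDimensional ℝ E] [MeasurableSpace E] [BorelSpace E] (f : sphere (0:E) 1 → ℂ) (hf : Continuous f) :
    Continuous (extOp f) := by
  unfold extOp
  refine continuous_of_dominated (bound := fun ω => ‖f ω‖) (fun x => ?_) (fun x => ?_) (sph_cont_int _ hf.norm) ?_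
  · apply Continuous.aestronglyMeasurable; fun_prop
  · exact Filter.Eventually.of_forall fun ω => by rw [norm_mul, Circle.norm_coe, mul_one]
  · exact Filter.Eventually.of_forall fun ω => by fun_prop

theorem extOp_bdd {E : Type*} [NormedAddCommGroup E] [InnerProductSpace ℝ E]
    [FiniteDimensional ℝ E] [MeasurableSpace E] [BorelSpace E] (f : sphere (0:E) 1 → ℂ) (x : E) :
    ‖extOp f x‖ ≤ ∫ ω, ‖f ω‖ ∂(volume : Measure E).toSphere := by
  unfold extOp
  refine (norm_integral_le_integral_norm _).trans (le_of_eq ?_)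
  congr 1 with ω
  rw [norm_mul, Circle.norm_coe, mul_one]

theorem set_est_fin {E : Type*} [NormedAddCommGroup E] [InnerProductSpace ℝ E]
    [FiniteDimensional ℝ E] [MeasurableSpace E] [BorelSpace E] (f : sphere (0:E) 1 → ℂ) (hf : Continuous f)
    (A : Set E) (hA : MeasurableSet A) (hAf : volume A < ⊤) (m : ℝ) (hm : 0 < m)
    (hen : ∀ h : E → ℂ, Integrable h → MemLp h 2 volume → (∀ x, x ∉ A → h x = 0) →
      ∫⁻ ω : sphere (0:E) 1, ‖𝓕 h ω‖ₑ ^ 2 ∂(volume : Measure E).toSphere ≤ ENNReal.ofReal m * ∫⁻ x, ‖h x‖ₑ ^ 2) :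
    ∫⁻ x in A, ‖extOp f x‖ₑ ^ 2 ≤ ENNReal.ofReal m * ∫⁻ ω, ‖f ω‖ₑ ^ 2 ∂(volume : Measure E).toSphere := by
  set σ := (volume : Measure E).toSphere
  set h : E → ℂ := A.indicator (extOp f) with hh
  have hcont := extOp_cont f hf
  set B := ∫ ω, ‖f ω‖ ∂σ
  have : IsFiniteMeasure (volume.restrict A) := ⟨by simpa using hAf⟩
  have h1 : Integrable h := by
    rw [hh, integrable_indicator_iff hA]
    exact Integrable.of_bound hcont.aestronglyMeasurable B (Filter.Eventually.of_forall fun x => extOp_bdd f x)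
  have h2 : MemLp h 2 volume := by
    rw [hh, memLp_indicator_iff_restrict hA]
    exact MemLp.of_bound hcont.aestronglyMeasurable B (Filter.Eventually.of_forall fun x => extOp_bdd f x)
  have h3 := hen h h1 h2 (fun x hx => Set.indicator_of_notMem hx _)
  have hD : ∫⁻ x in A, ‖extOp f x‖ₑ ^ 2 = ∫⁻ x, ‖h x‖ₑ ^ 2 := by
    rw [← lintegral_indicator hA]
    congr 1 with x
    by_cases hx : x ∈ A <;> simp [hh, hx]
  have hDf : ∫⁻ x, ‖h x‖ₑ ^ 2 ≠ ⊤ := by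
    have := (eLpNorm_lt_top_iff_lintegral_rpow_enorm_lt_top (by norm_num) (by norm_num)).1 h2.2
    simpa using this.ne
  rw [hD]
  set D := ∫⁻ x, ‖h x‖ₑ ^ 2
  have hcF : Continuous (𝓕 h) := VectorFourier.fourierIntegral_continuous Real.continuous_fourierChar (by exact continuous_inner) h1
  have e1 : ∫ x, (starRingEnd ℂ) (h x) * extOp f x = ∫ ω : sphere (0:E) 1, f ω * (starRingEnd ℂ) (𝓕 h ω) ∂σ := by
    have a1 : ∀ x, (starRingEnd ℂ) (h x) * extOp f x = ∫ ω : sphere (0:E) 1, (starRingEnd ℂ) (h x) * (f ω * (Real.fourierChar (inner ℝ x (ω:E)) : ℂ)) ∂σ := by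
      intro x
      rw [integral_const_mul]; rfl
    simp only [a1]
    rw [integral_integral_swap]
    · congr 1 with ω
      rw [Real.fourier_eq, ← integral_conj, ← integral_const_mul]
      congr 1 with x
      rw [Circle.smul_def, smul_eq_mul, map_mul, ← Circle.coe_inv_eq_conj, ← AddChar.map_neg_eq_inv, neg_neg]
      ring
    · have hc : Integrable (fun y => (starRingEnd ℂ) (h y)) :=
        (LinearIsometryEquiv.integrable_comp_iff Complex.conjLIE).2 h1
      have i2 := hc.mul_prod (sph_cont_int f hf)
      have i3 := i2.mul_bdd (c := 1) (g := fun z : E × sphere (0:E) 1 => (Real.fourierChar (inner ℝ z.1 (z.2:E)) : ℂ))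
        (Continuous.aestronglyMeasurable (by fun_prop)) (Filter.Eventually.of_forall fun z => (Circle.norm_coe _).le)
      refine i3.congr (Filter.Eventually.of_forall fun z => ?_)
      simp only [Function.uncurry]
      ring
  have e2 : ‖∫ x, (starRingEnd ℂ) (h x) * extOp f x‖ₑ = D := by
    have a1 : ∀ x, (starRingEnd ℂ) (h x) * extOp f x = ((‖h x‖ ^ 2 : ℝ) : ℂ) := by
      intro x
      rw [← Complex.normSq_eq_norm_sq, ← Complex.mul_conj, mul_comm]
      by_cases hx : x ∈ A <;> simp [hh, hx]
    simp only [a1]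
    rw [integral_complex_ofReal, ← ofReal_norm, Complex.norm_real, Real.norm_of_nonneg (integral_nonneg fun ω => by positivity),
      ofReal_integral_eq_lintegral_ofReal]
    · congr 1 with ω
      rw [ENNReal.ofReal_pow (norm_nonneg _), ofReal_norm]
    · exact h2.integrable_norm_pow (by norm_num)
    · exact Filter.Eventually.of_forall fun ω => by positivity
  set c := Real.sqrt m
  have hc : 0 < c := Real.sqrt_pos.2 hm
  have hcm : c ^ 2 = m := Real.sq_sqrt hm.le
  have key : 2 * D ≤ ENNReal.ofReal m * (∫⁻ ω, ‖f ω‖ₑ ^ 2 ∂σ) + D := by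
    calc 2 * D ≤ 2 * ∫⁻ ω : sphere (0:E) 1, ‖f ω * (starRingEnd ℂ) (𝓕 h ω)‖ₑ ∂σ := by
          rw [← e2, e1]
          gcongr
          exact enorm_integral_le_lintegral_enorm _
      _ = ∫⁻ ω : sphere (0:E) 1, 2 * ((ENNReal.ofReal c * ‖f ω‖ₑ) * (ENNReal.ofReal c⁻¹ * ‖𝓕 h ω‖ₑ)) ∂σ := by
          rw [← lintegral_const_mul' _ _ (by simp)]
          congr 1 with ω
          congr 1
          have : ‖(starRingEnd ℂ) (𝓕 h ω)‖ₑ = ‖𝓕 h ω‖ₑ := by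
            rw [← ofReal_norm, RCLike.norm_conj, ofReal_norm]
          rw [enorm_mul, this]
          calc _ = (ENNReal.ofReal c * ENNReal.ofReal c⁻¹) * (‖f ω‖ₑ * ‖𝓕 h ω‖ₑ) := by
                rw [← ENNReal.ofReal_mul hc.le, mul_inv_cancel₀ hc.ne']; simp
            _ = _ := by ring
      _ ≤ ∫⁻ ω : sphere (0:E) 1, (ENNReal.ofReal m * ‖f ω‖ₑ ^ 2 + ENNReal.ofReal m⁻¹ * ‖𝓕 h ω‖ₑ ^ 2) ∂σ := by
          refine lintegral_mono fun ω => (ennreal_two_mul _ _).trans (le_of_eq ?_)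
          rw [mul_pow, mul_pow, ← ENNReal.ofReal_pow hc.le, ← ENNReal.ofReal_pow (by positivity), inv_pow, hcm]
      _ = ENNReal.ofReal m * (∫⁻ ω, ‖f ω‖ₑ ^ 2 ∂σ) + ENNReal.ofReal m⁻¹ * ∫⁻ ω : sphere (0:E) 1, ‖𝓕 h ω‖ₑ ^ 2 ∂σ := by
          rw [lintegral_add_left (by have := hf.measurable; fun_prop), lintegral_const_mul' _ _ (by simp), lintegral_const_mul' _ _ (by simp)]
      _ ≤ ENNReal.ofReal m * (∫⁻ ω, ‖f ω‖ₑ ^ 2 ∂σ) + ENNReal.ofReal m⁻¹ * (ENNReal.ofReal m * D) := by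
          gcongr
      _ = _ := by
          rw [← mul_assoc (ENNReal.ofReal m⁻¹), ← ENNReal.ofReal_mul (by positivity), inv_mul_cancel₀ hm.ne']; simp
  rw [two_mul] at key
  exact (ENNReal.add_le_add_iff_right hDf).1 key

theorem set_est {E : Type*} [NormedAddCommGroup E] [InnerProductSpace ℝ E]
    [FiniteDimensional ℝ E] [MeasurableSpace E] [BorelSpace E] [Nontrivial E] (p : ℝ)
    (hd3 : 3 ≤ Module.finrank ℝ E) (hp : ((Module.finrank ℝ E : ℝ) - 1) / 2 < p) :
    ∃ a < (1:ℝ), ∃ C : ℝ, 0 < C ∧ ∀ (A : Set E), MeasurableSet A → ∀ l : ℝ, 0 < l →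
      (∀ (x : E) (r : ℝ), 0 < r → volume (A ∩ ball x r) ≤ ENNReal.ofReal (l ^ (-p) * r ^ ((Module.finrank ℝ E : ℝ) - 2 * p))) →
      ∀ f : sphere (0:E) 1 → ℂ, Continuous f →
      ∫⁻ x in A, ‖extOp f x‖ₑ ^ 2
        ≤ ENNReal.ofReal (C * (if 1 ≤ l then l ^ (-p) else l ^ (-a))) * ∫⁻ ω, ‖f ω‖ₑ ^ 2 ∂(volume : Measure E).toSphere := by
  obtain ⟨a, ha, C, hC, h⟩ := energy_level (E := E) p hd3 hp
  refine ⟨a, ha, C, hC, fun A hA l hl hvol f hf => ?_⟩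
  have hU : A = ⋃ k : ℕ, A ∩ ball (0:E) k := by
    rw [← Set.inter_iUnion, iUnion_ball_nat, Set.inter_univ]
  rw [hU, setLIntegral_iUnion_of_directed]
  · refine iSup_le fun k => ?_
    apply set_est_fin f hf _ (hA.inter measurableSet_ball) (lt_of_le_of_lt (measure_mono Set.inter_subset_right) measure_ball_lt_top)
    · split_ifs <;> positivity
    · intro h' i1 i2 hs
      refine h (A ∩ ball 0 k) (hA.inter measurableSet_ball) l hl (fun x r hr => ?_) h' i1 i2 hs
      refine le_trans (measure_mono ?_) (hvol x r hr)
      exact Set.inter_subset_inter_left _ Set.inter_subset_left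
  · apply Monotone.directed_le
    intro i j hij
    exact Set.inter_subset_inter_right _ (ball_subset_ball (by exact_mod_cast hij))

end Part8

section Part9
open MeasureTheory Metric Complex
open scoped ENNReal FourierTransform SchwartzMap

theorem weight_est {E : Type*} [NormedAddCommGroup E] [InnerProductSpace ℝ E]
    [FiniteDimensional ℝ E] [MeasurableSpace E] [BorelSpace E] [Nontrivial E] (p : ℝ)
    (hd3 : 3 ≤ Module.finrank ℝ E) (hp : ((Module.finrank ℝ E : ℝ) - 1) / 2 < p) :
    ∃ C : ℝ, 0 < C ∧ ∀ (w : E → ℝ), Measurable w →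
      (∀ (l : ℝ) (x : E) (r : ℝ), 0 < l → 0 < r → volume ({y | l ≤ w y} ∩ ball x r) ≤ ENNReal.ofReal (l ^ (-p) * r ^ ((Module.finrank ℝ E : ℝ) - 2 * p))) →
      ∀ f : sphere (0:E) 1 → ℂ, Continuous f →
      ∫⁻ x, ‖extOp f x‖ₑ ^ 2 * ENNReal.ofReal (w x)
        ≤ ENNReal.ofReal C * ∫⁻ ω, ‖f ω‖ₑ ^ 2 ∂(volume : Measure E).toSphere := by
  obtain ⟨a, ha, C, hC, h⟩ := set_est (E := E) p hd3 hp
  have hd3' : (3:ℝ) ≤ (Module.finrank ℝ E : ℝ) := by exact_mod_cast hd3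
  have hp1 : 1 < p := by linarith
  set c : ℤ → ℝ := fun k => 2 ^ (k + 1) * (C * (if 1 ≤ (2:ℝ) ^ k then ((2:ℝ) ^ k) ^ (-p) else ((2:ℝ) ^ k) ^ (-a))) with hc
  have hc0 : ∀ k, 0 ≤ c k := by
    intro k; simp only [hc]; split_ifs <;> positivity
  have hsum : Summable c := by
    apply Summable.of_nat_of_neg
    · have : (fun n : ℕ => c n) = fun n : ℕ => (2 * C) * ((2:ℝ) ^ (1 - p)) ^ n := by
        ext n
        simp only [hc]
        rw [if_pos (by exact_mod_cast one_le_pow₀ (by norm_num))]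
        have e : ((2:ℝ) ^ (1 - p)) ^ n = 2 ^ n * (2 ^ n) ^ (-p) := by
          rw [sub_eq_add_neg, Real.rpow_add (by norm_num), mul_pow, Real.rpow_one, ← Real.rpow_natCast (2 ^ (-p)), ← Real.rpow_mul (by norm_num),
            ← Real.rpow_natCast 2 n, ← Real.rpow_mul (by norm_num), mul_comm (-p)]
        rw [e, zpow_add₀ (by norm_num), zpow_natCast, zpow_one]
        ring
      rw [this]
      apply Summable.mul_left
      exact summable_geometric_of_lt_one (by positivity) (Real.rpow_lt_one_of_one_lt_of_neg (by norm_num) (by linarith))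
    · have : (fun n : ℕ => c (-n)) = fun n : ℕ => (2 * C) * ((2:ℝ) ^ (a - 1)) ^ n := by
        ext n
        simp only [hc]
        have e : ((2:ℝ) ^ (a - 1)) ^ n = 2 ^ (-n : ℤ) * ((2:ℝ) ^ (-n : ℤ)) ^ (-a) := by
          rw [← Real.rpow_natCast (2 ^ (a - 1)), ← Real.rpow_mul (by norm_num), ← Real.rpow_intCast 2, ← Real.rpow_mul (by norm_num), ← Real.rpow_add (by norm_num)]
          congr 1
          push_cast; ring
        have e2 : (if 1 ≤ (2:ℝ) ^ (-n : ℤ) then ((2:ℝ) ^ (-n : ℤ)) ^ (-p) else ((2:ℝ) ^ (-n : ℤ)) ^ (-a)) = ((2:ℝ) ^ (-n : ℤ)) ^ (-a) := by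
          split_ifs with h1
          · have h2 : (2:ℝ) ^ (-n : ℤ) ≤ 1 := zpow_le_one_of_nonpos₀ (by norm_num) (by simp)
            rw [le_antisymm h2 h1]; simp
          · rfl
        rw [e, e2, zpow_add₀ (by norm_num), zpow_one]
        ring
      rw [this]
      apply Summable.mul_left
      exact summable_geometric_of_lt_one (by positivity) (Real.rpow_lt_one_of_one_lt_of_neg (by norm_num) (by linarith))
  refine ⟨∑' k, c k + 1, add_pos_of_nonneg_of_pos (tsum_nonneg hc0) one_pos, fun w hw hvol f hf => ?_⟩
  have hfc := (extOp_cont f hf).measurable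
  calc ∫⁻ x, ‖extOp f x‖ₑ ^ 2 * ENNReal.ofReal (w x)
      ≤ ∫⁻ x, ∑' k : ℤ, {y | (2:ℝ) ^ k ≤ w y}.indicator (fun x => ENNReal.ofReal (2 ^ (k + 1)) * ‖extOp f x‖ₑ ^ 2) x := by
        refine lintegral_mono fun x => ?_
        simp only
        rcases le_or_gt (w x) 0 with h0 | h0
        · rw [ENNReal.ofReal_of_nonpos h0]; simp
        · obtain ⟨k, hk⟩ := exists_mem_Ico_zpow h0 (y := 2) (by norm_num)
          refine le_trans ?_ (ENNReal.le_tsum k)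
          rw [Set.indicator_of_mem (by exact hk.1), mul_comm]
          gcongr
          exact hk.2.le
    _ = ∑' k : ℤ, ENNReal.ofReal (2 ^ (k + 1)) * ∫⁻ x in {y | (2:ℝ) ^ k ≤ w y}, ‖extOp f x‖ₑ ^ 2 := by
        have hms : ∀ k : ℤ, MeasurableSet {y | (2:ℝ) ^ k ≤ w y} := fun k => measurableSet_le measurable_const hw
        rw [lintegral_tsum]
        · congr 1 with k
          rw [lintegral_indicator (hms k), lintegral_const_mul' _ _ (by simp)]
        · intro k
          exact (Measurable.indicator (by fun_prop) (hms k)).aemeasurable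
    _ ≤ ∑' k : ℤ, ENNReal.ofReal (c k) * ∫⁻ ω, ‖f ω‖ₑ ^ 2 ∂(volume : Measure E).toSphere := by
        refine ENNReal.tsum_le_tsum fun k => ?_
        simp only [hc]
        rw [ENNReal.ofReal_mul (by positivity), mul_assoc]
        gcongr
        exact h {y | (2:ℝ) ^ k ≤ w y} (measurableSet_le measurable_const hw) (2 ^ k) (by positivity) (fun x r hr => hvol _ x r (by positivity) hr) f hf
    _ = ENNReal.ofReal (∑' k, c k) * ∫⁻ ω, ‖f ω‖ₑ ^ 2 ∂(volume : Measure E).toSphere := by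
        rw [ENNReal.tsum_mul_right, ENNReal.ofReal_tsum_of_nonneg hc0 hsum]
    _ ≤ _ := by
        gcongr
        linarith

theorem weight_est_scaled {E : Type*} [NormedAddCommGroup E] [InnerProductSpace ℝ E]
    [FiniteDimensional ℝ E] [MeasurableSpace E] [BorelSpace E] [Nontrivial E] (p : ℝ)
    (hd3 : 3 ≤ Module.finrank ℝ E) (hp : ((Module.finrank ℝ E : ℝ) - 1) / 2 < p) :
    ∃ C : ℝ, 0 < C ∧ ∀ (w : E → ℝ), Measurable w → ∀ N : ℝ, 0 < N →
      (∀ (l : ℝ) (x : E) (r : ℝ), 0 < l → 0 < r → volume ({y | l ≤ w y} ∩ ball x r) ≤ ENNReal.ofReal ((l / N) ^ (-p) * r ^ ((Module.finrank ℝ E : ℝ) - 2 * p))) →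
      ∀ f : sphere (0:E) 1 → ℂ, Continuous f → ∀ ρ : ℝ, 0 < ρ →
      ENNReal.ofReal (ρ ^ (Module.finrank ℝ E - 2)) * ∫⁻ x, ‖extOp f (ρ • x)‖ₑ ^ 2 * ENNReal.ofReal (w x)
        ≤ ENNReal.ofReal (C * N) * ∫⁻ ω, ‖f ω‖ₑ ^ 2 ∂(volume : Measure E).toSphere := by
  obtain ⟨C, hC, h⟩ := weight_est (E := E) p hd3 hp
  refine ⟨C, hC, fun w hw N hN hvol f hf ρ hρ => ?_⟩
  set d := Module.finrank ℝ E with hd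
  let W : E → ℝ := fun y => w (ρ⁻¹ • y) / (N * ρ ^ 2)
  have hW : Measurable W := by
    have : Measurable (fun y : E => w (ρ⁻¹ • y)) := hw.comp (measurable_const_smul _)
    exact this.div_const _
  have hWvol : ∀ (l : ℝ) (x : E) (r : ℝ), 0 < l → 0 < r → volume ({y | l ≤ W y} ∩ ball x r) ≤ ENNReal.ofReal (l ^ (-p) * r ^ ((d : ℝ) - 2 * p)) := by
    intro l x r hl hr
    have hset : {y | l ≤ W y} ∩ ball x r = (fun y => ρ⁻¹ • y) ⁻¹' ({y | l * (N * ρ ^ 2) ≤ w y} ∩ ball (ρ⁻¹ • x) (ρ⁻¹ * r)) := by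
      ext y
      simp only [Set.mem_inter_iff, Set.mem_setOf_eq, Set.mem_preimage, mem_ball, W, dist_smul₀, Real.norm_of_nonneg (inv_pos.2 hρ).le]
      rw [le_div_iff₀ (by positivity), mul_lt_mul_iff_right₀ (inv_pos.2 hρ)]
    rw [hset, Measure.addHaar_preimage_smul _ (inv_pos.2 hρ).ne', abs_of_pos (by positivity)]
    refine (mul_le_mul_right (hvol _ _ _ (by positivity) (by positivity)) _).trans ?_
    rw [← ENNReal.ofReal_mul (by positivity)]
    apply ENNReal.ofReal_le_ofReal (le_of_eq ?_)
    have e1 : l * (N * ρ ^ 2) / N = l * ρ ^ 2 := by field_simp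
    rw [e1, Real.mul_rpow hl.le (by positivity), Real.mul_rpow (by positivity) hr.le, inv_pow, inv_inv]
    have e2 : ρ ^ d * ((ρ ^ 2) ^ (-p) * (ρ⁻¹) ^ ((d:ℝ) - 2 * p)) = 1 := by
      rw [Real.inv_rpow hρ.le, ← Real.rpow_neg hρ.le, ← Real.rpow_natCast, ← Real.rpow_natCast, ← Real.rpow_mul hρ.le, ← Real.rpow_add hρ, ← Real.rpow_add hρ]
      convert Real.rpow_zero ρ using 2
      push_cast; ring
    calc _ = (ρ ^ d * ((ρ ^ 2) ^ (-p) * (ρ⁻¹) ^ ((d:ℝ) - 2 * p))) * (l ^ (-p) * r ^ ((d:ℝ) - 2 * p)) := by rw [← hd]; ring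
      _ = _ := by rw [e2, one_mul]
  have key := h W hW hWvol f hf
  have hfc := (extOp_cont f hf).measurable
  rw [← lintegral_smul_scale (fun x => ‖extOp f x‖ₑ ^ 2 * ENNReal.ofReal (W x)) (by fun_prop) ρ hρ, ← hd] at key
  have e3 : ∀ x, ENNReal.ofReal (W (ρ • x)) = ENNReal.ofReal (w x) * ENNReal.ofReal (N * ρ ^ 2)⁻¹ := by
    intro x
    simp only [W, smul_smul, inv_mul_cancel₀ hρ.ne', one_smul]
    rw [div_eq_mul_inv, ENNReal.ofReal_mul' (by positivity)]
  simp only [e3, ← mul_assoc] at key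
  rw [lintegral_mul_const' _ _ (by simp)] at key
  have hρd : ρ ^ d = ρ ^ (d - 2) * ρ ^ 2 := by rw [← pow_add]; congr 1; omega
  calc _ = ENNReal.ofReal N * (ENNReal.ofReal (ρ ^ d) * ((∫⁻ x, ‖extOp f (ρ • x)‖ₑ ^ 2 * ENNReal.ofReal (w x)) * ENNReal.ofReal (N * ρ ^ 2)⁻¹)) := by
        rw [mul_comm (∫⁻ x, _) (ENNReal.ofReal (N * ρ ^ 2)⁻¹), ← mul_assoc, ← mul_assoc, ← ENNReal.ofReal_mul (by positivity), ← ENNReal.ofReal_mul (by positivity)]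
        congr 2
        rw [hρd]; field_simp
    _ ≤ ENNReal.ofReal N * (ENNReal.ofReal C * ∫⁻ ω, ‖f ω‖ₑ ^ 2 ∂(volume : Measure E).toSphere) := by
        gcongr
    _ = _ := by rw [← mul_assoc, ← ENNReal.ofReal_mul hN.le, mul_comm N C]

end Part9

section Part10
open MeasureTheory Metric Complex
open scoped ENNReal FourierTransform SchwartzMap

theorem fp_vol (n : ℕ) (p : ℝ) (hp : 0 < p) (V : EuclideanSpace ℝ (Fin n) → ℂ) (hV : Measurable V) (N : ℝ) (hN : 0 < N)
    (h : fpNorm n p V ≤ ENNReal.ofReal N) (l : ℝ) (x : EuclideanSpace ℝ (Fin n)) (r : ℝ) (hl : 0 < l) (hr : 0 < r) :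
    volume ({y | l ≤ ‖V y‖} ∩ ball x r) ≤ ENNReal.ofReal ((l / N) ^ (-p) * r ^ ((n : ℝ) - 2 * p)) := by
  set J := ∫⁻ y in ball x r, ENNReal.ofReal (‖V y‖ ^ p)
  have h1 : ENNReal.ofReal (r ^ (2 - n / p)) * J ^ (1 / p) ≤ ENNReal.ofReal N := by
    refine le_trans ?_ h
    unfold fpNorm
    exact le_iSup_of_le x (le_iSup_of_le r (le_iSup_of_le hr le_rfl))
  have h2 : J ^ (1 / p) ≤ ENNReal.ofReal (N * r ^ ((n:ℝ) / p - 2)) := by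
    calc J ^ (1 / p) = ENNReal.ofReal (r ^ ((n:ℝ) / p - 2)) * (ENNReal.ofReal (r ^ (2 - n / p)) * J ^ (1 / p)) := by
          rw [← mul_assoc, ← ENNReal.ofReal_mul (by positivity), ← Real.rpow_add hr]
          simp
      _ ≤ ENNReal.ofReal (r ^ ((n:ℝ) / p - 2)) * ENNReal.ofReal N := by gcongr
      _ = _ := by rw [← ENNReal.ofReal_mul (by positivity), mul_comm]
  have h3 : J ≤ ENNReal.ofReal (N ^ p * r ^ ((n:ℝ) - 2 * p)) := by
    have := ENNReal.rpow_le_rpow h2 hp.le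
    rw [← ENNReal.rpow_mul, one_div, inv_mul_cancel₀ hp.ne', ENNReal.rpow_one, ENNReal.ofReal_rpow_of_pos (by positivity),
      Real.mul_rpow hN.le (by positivity), ← Real.rpow_mul hr.le, sub_mul, div_mul_cancel₀ _ hp.ne'] at this
    exact this
  have hm : Measurable (fun y => ENNReal.ofReal (‖V y‖ ^ p)) := by fun_prop
  have h4 := mul_meas_ge_le_lintegral (μ := volume.restrict (ball x r)) hm (ENNReal.ofReal (l ^ p))
  rw [Measure.restrict_apply (measurableSet_le measurable_const hm)] at h4
  have h5 : volume ({y | l ≤ ‖V y‖} ∩ ball x r) ≤ volume ({y | ENNReal.ofReal (l ^ p) ≤ ENNReal.ofReal (‖V y‖ ^ p)} ∩ ball x r) := by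
    apply measure_mono
    apply Set.inter_subset_inter_left
    intro y hy
    exact ENNReal.ofReal_le_ofReal (Real.rpow_le_rpow hl.le hy hp.le)
  calc _ = ENNReal.ofReal (l ^ (-p)) * (ENNReal.ofReal (l ^ p) * volume ({y | l ≤ ‖V y‖} ∩ ball x r)) := by
        rw [← mul_assoc, ← ENNReal.ofReal_mul (by positivity), ← Real.rpow_add hl]
        simp
    _ ≤ ENNReal.ofReal (l ^ (-p)) * ENNReal.ofReal (N ^ p * r ^ ((n:ℝ) - 2 * p)) := by
        gcongr
        exact ((mul_le_mul_right h5 _).trans h4).trans h3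
    _ = _ := by
        rw [← ENNReal.ofReal_mul (by positivity), Real.div_rpow hl.le hN.le, Real.rpow_neg hN.le, div_inv_eq_mul]
        congr 1; ring

theorem sine_plancherel (G : ℝ → ℂ) (hG : Integrable G) (hG2 : MemLp G 2 volume) :
    ∫⁻ t : ℝ, ‖∫ r : ℝ, ((Real.sin (t * r) : ℝ) : ℂ) * G r‖ₑ ^ 2 ≤ ENNReal.ofReal (4 * Real.pi) * ∫⁻ r, ‖G r‖ₑ ^ 2 := by
  have hcF : Continuous (𝓕 G) := VectorFourier.fourierIntegral_continuous Real.continuous_fourierChar (by exact continuous_inner) hG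
  have h2pi : 0 < 2 * Real.pi := by positivity
  have e1 : ∀ t : ℝ, ∫ r : ℝ, ((Real.sin (t * r) : ℝ) : ℂ) * G r = (Complex.I / 2) * (𝓕 G ((2 * Real.pi)⁻¹ • t) - 𝓕 G ((2 * Real.pi)⁻¹ • -t)) := by
    intro t
    have i0 : ∀ s : ℝ, Integrable (fun r : ℝ => Real.fourierChar (-(inner ℝ r s)) • G r) := by
      intro s
      refine (Real.fourierIntegral_convergent_iff s).2 hG
    rw [Real.fourier_eq, Real.fourier_eq, ← integral_sub (i0 _) (i0 _), ← integral_const_mul]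
    congr 1 with r
    rw [Circle.smul_def, Circle.smul_def, Real.fourierChar_apply, Real.fourierChar_apply]
    have a1 : 2 * Real.pi * -(inner ℝ r ((2 * Real.pi)⁻¹ • t)) = -(t * r) := by
      simp; field_simp
    have a2 : 2 * Real.pi * -(inner ℝ r ((2 * Real.pi)⁻¹ • -t)) = t * r := by
      simp; field_simp
    rw [a1, a2, Complex.ofReal_sin, Complex.sin, smul_eq_mul, smul_eq_mul, ← sub_mul, ← mul_assoc]
    congr 1
    push_cast
    ring_nf
  have e2 : ∀ t : ℝ, ‖∫ r : ℝ, ((Real.sin (t * r) : ℝ) : ℂ) * G r‖ₑ ^ 2 ≤ ‖𝓕 G ((2 * Real.pi)⁻¹ • t)‖ₑ ^ 2 + ‖𝓕 G ((2 * Real.pi)⁻¹ • -t)‖ₑ ^ 2 := by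
    intro t
    rw [e1]
    set a := 𝓕 G ((2 * Real.pi)⁻¹ • t)
    set b := 𝓕 G ((2 * Real.pi)⁻¹ • -t)
    rw [← ofReal_norm, ← ofReal_norm, ← ofReal_norm, ← ENNReal.ofReal_pow (norm_nonneg _), ← ENNReal.ofReal_pow (norm_nonneg _), ← ENNReal.ofReal_pow (norm_nonneg _),
      ← ENNReal.ofReal_add (by positivity) (by positivity)]
    apply ENNReal.ofReal_le_ofReal
    have h1 := norm_sub_le a b
    have h3 : ‖Complex.I / 2‖ = 1 / 2 := by simp
    rw [norm_mul, h3]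
    nlinarith [norm_nonneg a, norm_nonneg b, norm_nonneg (a - b), sq_nonneg (‖a‖ - ‖b‖)]
  have e3 := lintegral_smul_scale (fun s : ℝ => ‖𝓕 G s‖ₑ ^ 2) (by fun_prop) (2 * Real.pi)⁻¹ (by positivity)
  simp only [Module.finrank_self, pow_one] at e3
  have e4 : ∫⁻ t : ℝ, ‖𝓕 G ((2 * Real.pi)⁻¹ • t)‖ₑ ^ 2 = ENNReal.ofReal (2 * Real.pi) * ∫⁻ r, ‖G r‖ₑ ^ 2 := by
    rw [← plancherel_lintegral hG hG2, ← e3, ← mul_assoc, ← ENNReal.ofReal_mul h2pi.le, mul_inv_cancel₀ h2pi.ne']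
    simp
  have e5 : ∫⁻ t : ℝ, ‖𝓕 G ((2 * Real.pi)⁻¹ • -t)‖ₑ ^ 2 = ∫⁻ t : ℝ, ‖𝓕 G ((2 * Real.pi)⁻¹ • t)‖ₑ ^ 2 :=
    lintegral_neg_eq_self (fun t : ℝ => ‖𝓕 G ((2 * Real.pi)⁻¹ • t)‖ₑ ^ 2)
  have hms : Measurable (fun t : ℝ => ‖𝓕 G ((2 * Real.pi)⁻¹ • t)‖ₑ ^ 2) := (hcF.comp (continuous_const_smul (2 * Real.pi)⁻¹)).measurable.enorm.pow_const 2
  refine (lintegral_mono e2).trans ?_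
  rw [lintegral_add_left hms, e5, e4, ← add_mul, ← ENNReal.ofReal_add (by positivity) (by positivity)]
  apply le_of_eq; congr 2; ring

theorem sing_integrable {E : Type*} [NormedAddCommGroup E] [InnerProductSpace ℝ E]
    [FiniteDimensional ℝ E] [MeasurableSpace E] [BorelSpace E] [Nontrivial E] (hd : 2 ≤ Module.finrank ℝ E)
    (F : E → ℂ) (hF : AEStronglyMeasurable F volume) (s : ℝ) (hs0 : 0 ≤ s) (hs : s ≤ 1) (C : ℝ) (hC : 0 ≤ C)
    (hb : ∀ x, ‖F x‖ ≤ C * (‖x‖ ^ (-s) * ((1 + ‖x‖) ^ (Module.finrank ℝ E + 1))⁻¹)) : Integrable F := by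
  refine ⟨hF, ?_⟩
  set d := Module.finrank ℝ E with hdd
  have hInt0 : Integrable (fun r : ℝ => C * ((1 + ‖r‖) ^ (-(2:ℝ)))) :=
    (integrable_one_add_norm (E := ℝ) (μ := volume) (r := 2) (by simp)).const_mul C
  have hfin : ∫⁻ r : ℝ, ENNReal.ofReal (C * ((1 + ‖r‖) ^ (-(2:ℝ)))) < ⊤ := by
    rw [← ofReal_integral_eq_lintegral_ofReal hInt0 (Filter.Eventually.of_forall fun x => by positivity)]
    simp
  calc ∫⁻ x, ‖F x‖ₑ ≤ ∫⁻ x, ENNReal.ofReal (C * (‖x‖ ^ (-s) * ((1 + ‖x‖) ^ (d + 1))⁻¹)) := by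
        refine lintegral_mono fun x => ?_
        simp only
        rw [← ofReal_norm]
        exact ENNReal.ofReal_le_ofReal (hb x)
    _ = _ := lintegral_polar _ (by fun_prop)
    _ ≤ ∫⁻ ω : sphere (0:E) 1, ∫⁻ r : ℝ, ENNReal.ofReal (C * ((1 + ‖r‖) ^ (-(2:ℝ)))) ∂volume ∂(volume : Measure E).toSphere := by
        refine lintegral_mono fun ω => ?_
        refine le_trans ?_ (setLIntegral_le_lintegral (Set.Ioi 0) _)
        refine setLIntegral_mono (by fun_prop) fun r hr => ?_
        have hr0 : 0 < r := hr
        have hn : ‖r • (ω:E)‖ = r := by rw [norm_smul, Real.norm_of_nonneg hr0.le]; simp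
        rw [hn, ← ENNReal.ofReal_mul (by positivity), Real.norm_of_nonneg hr0.le]
        apply ENNReal.ofReal_le_ofReal
        have e1 : r ^ (d - 1) * r ^ (-s) ≤ (1 + r) ^ (d - 1) := by
          rw [← Real.rpow_natCast, ← Real.rpow_add hr0, ← Real.rpow_natCast (1 + r)]
          have h1 : (1:ℝ) ≤ ((d - 1 : ℕ) : ℝ) := by
            have : 1 ≤ d - 1 := by omega
            exact_mod_cast this
          calc r ^ (((d - 1 : ℕ) : ℝ) + -s) ≤ (1 + r) ^ (((d - 1 : ℕ) : ℝ) + -s) := by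
                apply Real.rpow_le_rpow hr0.le (by linarith) (by linarith)
            _ ≤ _ := by
                apply Real.rpow_le_rpow_of_exponent_le (by linarith) (by linarith)
        have e2 : (1 + r) ^ (d + 1) = (1 + r) ^ (d - 1) * (1 + r) ^ 2 := by rw [← pow_add]; congr 1; omega
        calc _ = C * ((r ^ (d - 1) * r ^ (-s)) * ((1 + r) ^ (d + 1))⁻¹) := by rw [← hdd]; ring
          _ ≤ C * ((1 + r) ^ (d - 1) * ((1 + r) ^ (d + 1))⁻¹) := by gcongr
          _ = _ := by
            rw [e2, Real.rpow_neg (by positivity)]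
            norm_cast
            field_simp
    _ < ⊤ := by
        rw [lintegral_const]
        exact ENNReal.mul_lt_top hfin (measure_lt_top _ _)

end Part10

section Part11
open MeasureTheory Metric Complex
open scoped ENNReal FourierTransform SchwartzMap

theorem schwartz_decay {E : Type*} [NormedAddCommGroup E] [InnerProductSpace ℝ E] (ψ : 𝓢(E, ℂ)) (k : ℕ) :
    ∃ D : ℝ, 0 < D ∧ ∀ x, ‖ψ x‖ ≤ D * ((1 + ‖x‖) ^ k)⁻¹ := by
  refine ⟨2 ^ k * (Finset.Iic (k, 0)).sup (fun m => SchwartzMap.seminorm ℝ m.1 m.2) ψ + 1, by positivity, fun x => ?_⟩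
  have := SchwartzMap.one_add_le_sup_seminorm_apply (𝕜 := ℝ) (m := (k, 0)) (k := k) (n := 0) le_rfl le_rfl ψ x
  rw [norm_iteratedFDeriv_zero] at this
  rw [← div_eq_mul_inv, le_div_iff₀ (by positivity)]
  simp only at this
  linarith

theorem phi_cont {E : Type*} [NormedAddCommGroup E] [InnerProductSpace ℝ E]
    [FiniteDimensional ℝ E] [MeasurableSpace E] [BorelSpace E] [Nontrivial E] (ψ : 𝓢(E, ℂ)) :
    Continuous (fun z : ℝ × E => extOp (fun ω : sphere (0:E) 1 => ψ (z.1 • (ω:E))) (z.1 • z.2)) := by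
  obtain ⟨D, hD, hψ⟩ := schwartz_decay ψ 0
  have hψc := ψ.continuous
  unfold extOp
  refine continuous_of_dominated (bound := fun _ => D) (fun z => ?_) (fun z => ?_) (integrable_const _) ?_
  · apply Continuous.aestronglyMeasurable
    fun_prop
  · refine Filter.Eventually.of_forall fun ω => ?_
    rw [norm_mul, Circle.norm_coe, mul_one]
    simpa using hψ (z.1 • (ω:E))
  · refine Filter.Eventually.of_forall fun ω => ?_
    fun_prop

/-- The radial profile. -/
noncomputable def gProf {E : Type*} [NormedAddCommGroup E] [InnerProductSpace ℝ E]
    [FiniteDimensional ℝ E] [MeasurableSpace E] [BorelSpace E] (ψ : 𝓢(E, ℂ)) (x : E) (r : ℝ) : ℂ :=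
  (Set.Ioi (0:ℝ)).indicator (fun _ => (1:ℂ)) r * (((r ^ (Module.finrank ℝ E - 2) : ℝ) : ℂ) *
    extOp (fun ω : sphere (0:E) 1 => ψ (r • (ω:E))) (r • x))

section
variable {E : Type*} [NormedAddCommGroup E] [InnerProductSpace ℝ E]
    [FiniteDimensional ℝ E] [MeasurableSpace E] [BorelSpace E] [Nontrivial E]

theorem gProf_meas (ψ : 𝓢(E, ℂ)) : Measurable (fun z : E × ℝ => gProf ψ z.1 z.2) := by
  unfold gProf
  have h1 : Measurable (fun r : ℝ => (Set.Ioi (0:ℝ)).indicator (fun _ => (1:ℂ)) r) :=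
    measurable_const.indicator measurableSet_Ioi
  have h2 : Measurable (fun z : E × ℝ => extOp (fun ω : sphere (0:E) 1 => ψ (z.2 • (ω:E))) (z.2 • z.1)) :=
    ((phi_cont ψ).comp continuous_swap).measurable
  refine (h1.comp measurable_snd).mul (Measurable.mul ?_ h2)
  fun_prop

theorem gProf_bd (hd : 2 ≤ Module.finrank ℝ E) (ψ : 𝓢(E, ℂ)) : ∃ D : ℝ, 0 < D ∧ ∀ x r, ‖gProf ψ x r‖ ≤ D * (1 + ‖r‖) ^ (-(2:ℝ)) := by
  obtain ⟨D, hD, hψ⟩ := schwartz_decay ψ (Module.finrank ℝ E)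
  set d := Module.finrank ℝ E with hdd
  set S := (volume : Measure E).toSphere.real Set.univ
  have hS : 0 ≤ S := measureReal_nonneg
  refine ⟨D * S + 1, by positivity, fun x r => ?_⟩
  by_cases hr : 0 < r
  · unfold gProf
    rw [Set.indicator_of_mem (show r ∈ Set.Ioi 0 from hr), one_mul, norm_mul, Complex.norm_real, Real.norm_of_nonneg hr.le, Real.norm_of_nonneg (by positivity), ← hdd]
    have h1 : ‖extOp (fun ω : sphere (0:E) 1 => ψ (r • (ω:E))) (r • x)‖ ≤ D * ((1 + r) ^ d)⁻¹ * S := by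
      refine (extOp_bdd _ _).trans ?_
      have hψc := ψ.continuous
      calc _ ≤ ∫ ω : sphere (0:E) 1, D * ((1 + r) ^ d)⁻¹ ∂(volume : Measure E).toSphere := by
            refine integral_mono (Continuous.integrable_of_hasCompactSupport (by fun_prop) (HasCompactSupport.of_compactSpace _)) (integrable_const _) fun ω => ?_
            have := hψ (r • (ω:E))
            have hn : ‖r • (ω:E)‖ = r := by rw [norm_smul, Real.norm_of_nonneg hr.le]; simp
            rwa [hn] at this
        _ = _ := by
            rw [integral_const, smul_eq_mul, mul_comm]
    have e2 : (1 + r) ^ d = (1 + r) ^ (d - 2) * (1 + r) ^ 2 := by rw [← pow_add]; congr 1; omega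
    calc _ ≤ (1 + r) ^ (d - 2) * (D * ((1 + r) ^ d)⁻¹ * S) := by
          gcongr
          linarith
      _ = (D * S) * (1 + r) ^ (-(2:ℝ)) := by
          rw [e2, Real.rpow_neg (by positivity)]
          norm_cast
          field_simp
      _ ≤ _ := by
          gcongr
          linarith
  · unfold gProf
    rw [Set.indicator_of_notMem (by simpa using hr)]
    simp only [zero_mul, norm_zero]
    positivity

theorem gProf_int (hd : 2 ≤ Module.finrank ℝ E) (ψ : 𝓢(E, ℂ)) (x : E) : Integrable (gProf ψ x) := by
  obtain ⟨D, hD, h⟩ := gProf_bd hd ψ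
  refine Integrable.mono' ((integrable_one_add_norm (E := ℝ) (μ := volume) (r := 2) (by simp)).const_mul D)
    ((gProf_meas ψ).comp measurable_prodMk_left).aestronglyMeasurable (Filter.Eventually.of_forall fun r => h x r)

theorem gProf_L2 (hd : 2 ≤ Module.finrank ℝ E) (ψ : 𝓢(E, ℂ)) (x : E) : MemLp (gProf ψ x) 2 volume := by
  obtain ⟨D, hD, h⟩ := gProf_bd hd ψ
  have h1 := gProf_int hd ψ x
  rw [memLp_two_iff_integrable_sq_norm h1.1]
  refine (h1.norm.const_mul D).mono' (h1.1.norm.pow 2) (Filter.Eventually.of_forall fun r => ?_)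
  have h2 := h x r
  have h3 : (1 + ‖r‖) ^ (-(2:ℝ)) ≤ 1 := Real.rpow_le_one_of_one_le_of_nonpos (by linarith [norm_nonneg r]) (by norm_num)
  have h4 : ‖gProf ψ x r‖ ≤ D := h2.trans (by nlinarith)
  rw [Real.norm_of_nonneg (by positivity), sq]
  gcongr

theorem u_eq (hd : 2 ≤ Module.finrank ℝ E) (ψ : 𝓢(E, ℂ)) (x : E) (t : ℝ) :
    𝓕⁻ (fun ξ : E => sincMult t ‖ξ‖ * ψ ξ) x = ∫ r : ℝ, ((Real.sin (t * r) : ℝ) : ℂ) * gProf ψ x r := by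
  have hψc := ψ.continuous
  have hInt0 : Integrable (fun ξ : E => Real.fourierChar (inner ℝ ξ x) • (sincMult t ‖ξ‖ * ψ ξ)) := by
    refine (ψ.integrable.norm.const_mul |t|).mono' ?_ (Filter.Eventually.of_forall fun ξ => ?_)
    · unfold sincMult
      apply Measurable.aestronglyMeasurable
      have h1 : Continuous (fun ξ : E => (Real.fourierChar (inner ℝ ξ x) : ℂ)) := by fun_prop
      simp only [Circle.smul_def]
      refine Measurable.smul h1.measurable ?_
      fun_prop
    · rw [Circle.norm_smul, norm_mul]
      gcongr
      unfold sincMult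
      rw [Complex.norm_real, norm_div, Real.norm_eq_abs, norm_norm]
      refine div_le_of_le_mul₀ (norm_nonneg _) (abs_nonneg _) ?_
      have := Real.abs_sin_le_abs (x := t * ‖ξ‖)
      rwa [abs_mul, abs_norm] at this
  rw [Real.fourierInv_eq, (integral_polar _ hInt0).2, ← integral_indicator measurableSet_Ioi]
  congr 1 with r
  by_cases hr : 0 < r
  · rw [Set.indicator_of_mem (show r ∈ Set.Ioi 0 from hr)]
    unfold gProf extOp
    rw [Set.indicator_of_mem (show r ∈ Set.Ioi 0 from hr), one_mul, ← mul_assoc, ← integral_const_mul, ← integral_smul]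
    congr 1 with ω
    have hn : ‖r • (ω:E)‖ = r := by rw [norm_smul, Real.norm_of_nonneg hr.le]; simp
    rw [hn, Circle.smul_def, smul_eq_mul, Complex.real_smul, real_inner_smul_left, real_inner_smul_left, real_inner_comm]
    unfold sincMult
    have e2 : r ^ (Module.finrank ℝ E - 1) = r ^ (Module.finrank ℝ E - 2) * r := by rw [← pow_succ]; congr 1; omega
    rw [e2]
    push_cast
    have : (r:ℂ) ≠ 0 := by exact_mod_cast hr.ne'
    field_simp
  · rw [Set.indicator_of_notMem (by simpa using hr)]
    unfold gProf
    rw [Set.indicator_of_notMem (by simpa using hr)]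
    simp

theorem wave_est (hd : 3 ≤ Module.finrank ℝ E) (ψ : 𝓢(E, ℂ)) (w : E → ℝ) (hw : Measurable w) (K : ℝ≥0∞) (hKt : K ≠ ⊤)
    (hK : ∀ f : sphere (0:E) 1 → ℂ, Continuous f → ∀ ρ : ℝ, 0 < ρ →
      ENNReal.ofReal (ρ ^ (Module.finrank ℝ E - 2)) * ∫⁻ x, ‖extOp f (ρ • x)‖ₑ ^ 2 * ENNReal.ofReal (w x) ≤
        K * ∫⁻ ω, ‖f ω‖ₑ ^ 2 ∂(volume : Measure E).toSphere) :
    ∫⁻ t : ℝ, ∫⁻ x : E, ‖𝓕⁻ (fun ξ : E => sincMult t ‖ξ‖ * ψ ξ) x‖ₑ ^ 2 * ENNReal.ofReal (w x) ≤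
      ENNReal.ofReal (4 * Real.pi) * (K * ∫⁻ ξ : E, ENNReal.ofReal (‖ξ‖⁻¹) * ‖ψ ξ‖ₑ ^ 2) := by
  have hd2 : 2 ≤ Module.finrank ℝ E := by omega
  have hψc := ψ.continuous
  have hgm := gProf_meas ψ
  simp only [u_eq hd2]
  have hm : Measurable (fun z : ℝ × E => ∫ r : ℝ, ((Real.sin (z.1 * r) : ℝ) : ℂ) * gProf ψ z.2 r) := by
    apply StronglyMeasurable.measurable
    apply StronglyMeasurable.integral_prod_right (f := fun z : (ℝ × E) => fun r : ℝ => ((Real.sin (z.1 * r) : ℝ) : ℂ) * gProf ψ z.2 r)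
    apply Measurable.stronglyMeasurable
    refine Measurable.mul (by fun_prop) ?_
    exact hgm.comp (f := fun q : (ℝ × E) × ℝ => (q.1.2, q.2)) (by fun_prop)
  rw [lintegral_lintegral_swap (by
    apply Measurable.aemeasurable
    exact (hm.enorm.pow_const 2).mul (by fun_prop))]
  calc _ = ∫⁻ x : E, (∫⁻ t : ℝ, ‖∫ r : ℝ, ((Real.sin (t * r) : ℝ) : ℂ) * gProf ψ x r‖ₑ ^ 2) * ENNReal.ofReal (w x) := by
        refine lintegral_congr fun x => ?_
        rw [lintegral_mul_const' _ _ (by simp)]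
    _ ≤ ∫⁻ x : E, (ENNReal.ofReal (4 * Real.pi) * ∫⁻ r, ‖gProf ψ x r‖ₑ ^ 2) * ENNReal.ofReal (w x) := by
        gcongr with x
        exact sine_plancherel _ (gProf_int hd2 ψ x) (gProf_L2 hd2 ψ x)
    _ = ENNReal.ofReal (4 * Real.pi) * ∫⁻ x : E, ∫⁻ r, ‖gProf ψ x r‖ₑ ^ 2 * ENNReal.ofReal (w x) := by
        rw [← lintegral_const_mul' _ _ ENNReal.ofReal_ne_top]
        refine lintegral_congr fun x => ?_
        rw [lintegral_mul_const' _ _ (by simp), mul_assoc]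
    _ = ENNReal.ofReal (4 * Real.pi) * ∫⁻ r, ∫⁻ x : E, ‖gProf ψ x r‖ₑ ^ 2 * ENNReal.ofReal (w x) := by
        congr 1
        apply lintegral_lintegral_swap
        apply Measurable.aemeasurable
        exact (hgm.enorm.pow_const 2).mul (by fun_prop)
    _ ≤ ENNReal.ofReal (4 * Real.pi) * ∫⁻ r, (Set.Ioi (0:ℝ)).indicator (fun r => K * ∫⁻ ω : sphere (0:E) 1, ENNReal.ofReal (r ^ (Module.finrank ℝ E - 2)) * ‖ψ (r • (ω:E))‖ₑ ^ 2 ∂(volume : Measure E).toSphere) r := by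
        gcongr with r
        by_cases hr : 0 < r
        · rw [Set.indicator_of_mem (show r ∈ Set.Ioi 0 from hr), lintegral_const_mul' _ _ (by simp)]
          have h1 := hK (fun ω => ψ (r • (ω:E))) (by fun_prop) r hr
          calc _ = ENNReal.ofReal (r ^ (Module.finrank ℝ E - 2)) * (ENNReal.ofReal (r ^ (Module.finrank ℝ E - 2)) * ∫⁻ x, ‖extOp (fun ω : sphere (0:E) 1 => ψ (r • (ω:E))) (r • x)‖ₑ ^ 2 * ENNReal.ofReal (w x)) := by
                rw [← mul_assoc, ← lintegral_const_mul' _ _ (by finiteness)]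
                refine lintegral_congr fun x => ?_
                unfold gProf
                rw [Set.indicator_of_mem (show r ∈ Set.Ioi 0 from hr), one_mul, enorm_mul, ← ofReal_norm (((r ^ (Module.finrank ℝ E - 2) : ℝ) : ℂ)), Complex.norm_real, Real.norm_of_nonneg (by positivity)]
                ring
            _ ≤ _ := by
                refine (mul_le_mul_right h1 _).trans (le_of_eq ?_)
                ring
        · rw [Set.indicator_of_notMem (by simpa using hr)]
          unfold gProf
          rw [Set.indicator_of_notMem (by simpa using hr)]
          simp
    _ = _ := by
        congr 1
        rw [lintegral_indicator measurableSet_Ioi, lintegral_const_mul' _ _ hKt]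
        congr 1
        rw [lintegral_polar _ (by fun_prop), lintegral_lintegral_swap (by
          apply Measurable.aemeasurable
          have hc : Continuous (fun z : ℝ × sphere (0:E) 1 => ψ (z.1 • (z.2:E))) := by fun_prop
          refine Measurable.mul (by fun_prop) (hc.measurable.enorm.pow_const 2))]
        refine lintegral_congr fun ω => setLIntegral_congr_fun measurableSet_Ioi fun r hr => ?_
        have hr0 : 0 < r := hr
        have hn : ‖r • (ω:E)‖ = r := by rw [norm_smul, Real.norm_of_nonneg hr0.le]; simp
        rw [hn, ← mul_assoc, ← ENNReal.ofReal_mul (by positivity)]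
        have e2 : r ^ (Module.finrank ℝ E - 1) = r ^ (Module.finrank ℝ E - 2) * r := by rw [← pow_succ]; congr 1; omega
        rw [e2, mul_assoc, mul_inv_cancel₀ hr0.ne', mul_one]

theorem rhs_eq (hd : 2 ≤ Module.finrank ℝ E) (ψ : 𝓢(E, ℂ)) :
    eLpNorm (𝓕⁻ (fun ξ : E => powMult (-(1/2)) ‖ξ‖ * ψ ξ)) 2 volume ^ 2 = ∫⁻ ξ : E, ENNReal.ofReal (‖ξ‖⁻¹) * ‖ψ ξ‖ₑ ^ 2 ∧
    ∫⁻ ξ : E, ENNReal.ofReal (‖ξ‖⁻¹) * ‖ψ ξ‖ₑ ^ 2 ≠ ⊤ := by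
  have hψc := ψ.continuous
  obtain ⟨D, hD, hψ⟩ := schwartz_decay ψ (Module.finrank ℝ E + 1)
  set F : E → ℂ := fun ξ => powMult (-(1/2)) ‖ξ‖ * ψ ξ with hF
  have hFm : Measurable F := by
    rw [hF]; unfold powMult
    fun_prop
  have hFn : ∀ ξ, ‖F ξ‖ = ‖ξ‖ ^ (-(1/2) : ℝ) * ‖ψ ξ‖ := by
    intro ξ
    simp only [hF, powMult]
    rw [norm_mul, Complex.norm_real, Real.norm_of_nonneg (by positivity)]
  have hsq : ∀ ξ : E, (‖ξ‖ ^ (-(1/2) : ℝ)) ^ 2 = ‖ξ‖⁻¹ := by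
    intro ξ
    rw [← Real.rpow_natCast, ← Real.rpow_mul (norm_nonneg _)]
    norm_num
    exact Real.rpow_neg_one _
  have h1 : Integrable F := by
    refine sing_integrable hd F hFm.aestronglyMeasurable (1/2) (by norm_num) (by norm_num) D hD.le fun x => ?_
    rw [hFn]
    calc _ ≤ ‖x‖ ^ (-(1/2) : ℝ) * (D * ((1 + ‖x‖) ^ (Module.finrank ℝ E + 1))⁻¹) := by
          gcongr; exact hψ x
      _ = _ := by ring
  have h2 : Integrable (fun ξ => F ξ ^ 2) := by
    refine sing_integrable hd _ (hFm.pow_const 2).aestronglyMeasurable 1 (by norm_num) (by norm_num) (D ^ 2) (by positivity) fun x => ?_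
    rw [norm_pow, hFn, mul_pow, hsq, Real.rpow_neg_one]
    have h3 : ((1 + ‖x‖) ^ (Module.finrank ℝ E + 1))⁻¹ ≤ 1 := by
      apply inv_le_one_of_one_le₀
      apply one_le_pow₀
      linarith [norm_nonneg x]
    have h4 : 0 ≤ ((1 + ‖x‖) ^ (Module.finrank ℝ E + 1))⁻¹ := by positivity
    calc _ ≤ ‖x‖⁻¹ * (D * ((1 + ‖x‖) ^ (Module.finrank ℝ E + 1))⁻¹) ^ 2 := by
          gcongr; exact hψ x
      _ = D ^ 2 * (‖x‖⁻¹ * (((1 + ‖x‖) ^ (Module.finrank ℝ E + 1))⁻¹ * ((1 + ‖x‖) ^ (Module.finrank ℝ E + 1))⁻¹)) := by ring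
      _ ≤ D ^ 2 * (‖x‖⁻¹ * (((1 + ‖x‖) ^ (Module.finrank ℝ E + 1))⁻¹ * 1)) := by gcongr
      _ = _ := by ring
  have h3 : MemLp F 2 volume := by
    rw [memLp_two_iff_integrable_sq_norm h1.1]
    exact h2.norm.congr (Filter.Eventually.of_forall fun x => norm_pow _ _)
  have hpt : ∀ ξ, ENNReal.ofReal (‖ξ‖⁻¹) * ‖ψ ξ‖ₑ ^ 2 = ‖F ξ‖ₑ ^ 2 := by
    intro ξ
    rw [← ofReal_norm (F ξ), hFn, ENNReal.ofReal_mul (by positivity), mul_pow, ← ENNReal.ofReal_pow (by positivity), hsq, ofReal_norm]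
  have e : eLpNorm F 2 volume ^ 2 = ∫⁻ ξ : E, ENNReal.ofReal (‖ξ‖⁻¹) * ‖ψ ξ‖ₑ ^ 2 := by
    simp only [hpt]
    rw [eLpNorm_eq_lintegral_rpow_enorm_toReal (by norm_num) (by norm_num), ← ENNReal.rpow_natCast, ← ENNReal.rpow_mul]
    norm_num
  rw [plancherel_inv h1 h3, e]
  refine ⟨rfl, ?_⟩
  rw [← e]
  exact ENNReal.pow_ne_top h3.2.ne
end

theorem weighted_main (n : ℕ) (hn : 3 ≤ n) (p : ℝ) (hp : ((n : ℝ) - 1) / 2 < p) :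
    ∃ C > (0 : ℝ), ∀ V : EuclideanSpace ℝ (Fin n) → ℂ, Measurable V →
      fpNorm n p V < ⊤ →
      ∀ g : 𝓢(EuclideanSpace ℝ (Fin n), ℂ),
        wtNorm n (fun x => (‖V x‖₊ : ℝ≥0∞)) (fun x t => mOp n (sincMult t) (⇑g) x) ≤
          ENNReal.ofReal C * fpNorm n p V ^ ((1 : ℝ) / 2) *
            eLpNorm (mOp n (powMult (-(1 / 2))) (⇑g)) 2 volume := by
  have hfr : Module.finrank ℝ (EuclideanSpace ℝ (Fin n)) = n := finrank_euclideanSpace_fin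
  have hnt : Nontrivial (EuclideanSpace ℝ (Fin n)) := Module.nontrivial_of_finrank_pos (R := ℝ) (by omega)
  have hn' : (3:ℝ) ≤ n := by exact_mod_cast hn
  have hp0 : 0 < p := by linarith
  obtain ⟨C, hC, hest⟩ := weight_est_scaled (E := EuclideanSpace ℝ (Fin n)) p (by omega) (by rw [hfr]; exact hp)
  rw [hfr] at hest
  refine ⟨Real.sqrt (4 * Real.pi * C), by positivity, fun V hV hfin g => ?_⟩
  obtain ⟨hR, hRt⟩ := rhs_eq (E := EuclideanSpace ℝ (Fin n)) (by omega) (𝓕 g)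
  set X := ∫⁻ ξ : EuclideanSpace ℝ (Fin n), ENNReal.ofReal (‖ξ‖⁻¹) * ‖(𝓕 g) ξ‖ₑ ^ 2 with hX
  set L := ∫⁻ t : ℝ, ∫⁻ x : EuclideanSpace ℝ (Fin n), (‖mOp n (sincMult t) (⇑g) x‖₊ : ℝ≥0∞) ^ (2 : ℝ) * (‖V x‖₊ : ℝ≥0∞) with hL
  have hLe : L = ∫⁻ t : ℝ, ∫⁻ x : EuclideanSpace ℝ (Fin n), ‖𝓕⁻ (fun ξ : EuclideanSpace ℝ (Fin n) => sincMult t ‖ξ‖ * (𝓕 g) ξ) x‖ₑ ^ 2 * ENNReal.ofReal ‖V x‖ := by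
    rw [hL]
    refine lintegral_congr fun t => lintegral_congr fun x => ?_
    rw [ENNReal.rpow_two, ofReal_norm]
    rfl
  have key : ∀ N : ℝ, 0 < N → fpNorm n p V ≤ ENNReal.ofReal N → L ≤ ENNReal.ofReal (4 * Real.pi * C) * X * ENNReal.ofReal N := by
    intro N hN hle
    have h1 := wave_est (E := EuclideanSpace ℝ (Fin n)) (by omega) (𝓕 g) (fun x => ‖V x‖) hV.norm (ENNReal.ofReal (C * N)) ENNReal.ofReal_ne_top (by
      intro f hf ρ hρ
      rw [hfr]
      exact hest (fun x => ‖V x‖) hV.norm N hN (fun l x r hl hr => fp_vol n p hp0 V hV N hN hle l x r hl hr) f hf ρ hρ)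
    rw [hLe]
    refine h1.trans (le_of_eq ?_)
    rw [← hX, ENNReal.ofReal_mul hC.le, ENNReal.ofReal_mul (p := 4 * Real.pi) (by positivity)]
    ring
  have main : L ≤ ENNReal.ofReal (4 * Real.pi * C) * X * fpNorm n p V := by
    have hA : ENNReal.ofReal (4 * Real.pi * C) * X ≠ ⊤ := ENNReal.mul_ne_top ENNReal.ofReal_ne_top hRt
    by_cases h0 : fpNorm n p V = 0
    · have hlim : Filter.Tendsto (fun N : ℝ => ENNReal.ofReal (4 * Real.pi * C) * X * ENNReal.ofReal N) (nhdsWithin 0 (Set.Ioi 0)) (nhds (ENNReal.ofReal (4 * Real.pi * C) * X * ENNReal.ofReal 0)) :=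
        ENNReal.Tendsto.const_mul ((ENNReal.continuous_ofReal.tendsto 0).mono_left nhdsWithin_le_nhds) (Or.inr hA)
      rw [ENNReal.ofReal_zero] at hlim
      rw [h0]
      refine ge_of_tendsto hlim ?_
      filter_upwards [self_mem_nhdsWithin] with N hN
      exact key N hN (by rw [h0]; exact zero_le)
    · have h1 := key (fpNorm n p V).toReal (ENNReal.toReal_pos h0 hfin.ne) (by rw [ENNReal.ofReal_toReal hfin.ne])
      rwa [ENNReal.ofReal_toReal hfin.ne] at h1
  have hRe : eLpNorm (mOp n (powMult (-(1 / 2))) (⇑g)) 2 volume ^ 2 = X := hR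
  unfold wtNorm
  change L ^ ((1:ℝ)/2) ≤ _
  have hsqrt : ENNReal.ofReal (4 * Real.pi * C) ^ ((1:ℝ)/2) = ENNReal.ofReal (Real.sqrt (4 * Real.pi * C)) := by
    rw [Real.sqrt_eq_rpow, ENNReal.ofReal_rpow_of_nonneg (by positivity) (by norm_num)]
  calc L ^ ((1:ℝ)/2) ≤ (ENNReal.ofReal (4 * Real.pi * C) * X * fpNorm n p V) ^ ((1:ℝ)/2) := by gcongr
    _ = _ := by
      rw [ENNReal.mul_rpow_of_nonneg _ _ (by norm_num), ENNReal.mul_rpow_of_nonneg _ _ (by norm_num), hsqrt, ← hRe, ← ENNReal.rpow_natCast, ← ENNReal.rpow_mul]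
      norm_num
      ring

end Part11

/-- Weighted space-time `L²` estimate for `sin(t√−Δ)/√−Δ`. -/
theorem weighted_L2_sinc (n : ℕ) (hn : 3 ≤ n) (p : ℝ) (hp : ((n : ℝ) - 1) / 2 < p) :
    ∃ C > (0 : ℝ), ∀ V : EuclideanSpace ℝ (Fin n) → ℂ, Measurable V →
      fpNorm n p V < ⊤ →
      ∀ g : 𝓢(EuclideanSpace ℝ (Fin n), ℂ),
        wtNorm n (fun x => (‖V x‖₊ : ℝ≥0∞)) (fun x t => mOp n (sincMult t) (⇑g) x) ≤
          ENNReal.ofReal C * fpNorm n p V ^ ((1 : ℝ) / 2) *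
            eLpNorm (mOp n (powMult (-(1 / 2))) (⇑g)) 2 volume := by
  exact weighted_main n hn p hp

end
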